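/- arXiv:2411.18874 — 3 statements merged into one kernel-verified Lean document; each statement's English description precedes it below -/
import Mathlib

section
/- For every integer d ≥ 1 there exists a constant C > 0, depending only on d, such that for every integer N ≥ 3 the following holds: if 0 is an eigenvalue of the discrete torus T^d_N and d ∉ I(0;N), then the multiplicity satisfies m_{T^d_N}(0) ≤ C. -/
/-- The multiplicity of `μ` as an eigenvalue of the discrete torus `T^d_N`:
the number of tuples `(k_1, …, k_d) ∈ {0, …, N-1}^d` with
`∑_j 2 cos(2π k_j / N) = μ`. -/
noncomputable def torusMult (N d : ℕ) (μ : ℝ) : ℕ :=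
  Nat.card {k : Fin d → Fin N //
    (∑ j, 2 * Real.cos (2 * Real.pi * (k j : ℝ) / N)) = μ}

/-- The set `I(0;N)`: positive integers `r` such that `2r = ∑ b_l p_l` over the
distinct prime factors `p_l` of `N`, with at least one `b_l ≥ 2`. -/
def IZeroSet (N : ℕ) : Set ℕ :=
  {r | 0 < r ∧ ∃ b : ℕ → ℕ,
    2 * r = ∑ p ∈ N.primeFactors, b p * p ∧ ∃ p ∈ N.primeFactors, 2 ≤ b p}

open IntermediateField Polynomial

theorem finrank_adjoin_primitiveRoot {n : ℕ} (hn : n ≠ 0) {ζ : ℂ} (hζ : IsPrimitiveRoot ζ n) :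
    Module.finrank ℚ ℚ⟮ζ⟯ = n.totient := by
  rw [adjoin.finrank (hζ.isIntegral (Nat.pos_of_ne_zero hn)).tower_top,
    ← cyclotomic_eq_minpoly_rat hζ (Nat.pos_of_ne_zero hn), natDegree_cyclotomic]

theorem totient_le_natDegree_minpoly {m n : ℕ} (hm : m ≠ 0) (hn : n ≠ 0) {ζ η ω : ℂ}
    (hζ : IsPrimitiveRoot ζ m) (hη : IsPrimitiveRoot η n) (hω : IsIntegral ℚ⟮ζ⟯ ω)
    (hmem : η ∈ ℚ⟮ζ⟯⟮ω⟯) :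
    n.totient ≤ m.totient * (minpoly ℚ⟮ζ⟯ ω).natDegree := by
  have : FiniteDimensional ℚ ℚ⟮ζ⟯ :=
    adjoin.finiteDimensional (hζ.isIntegral (Nat.pos_of_ne_zero hm)).tower_top
  have : FiniteDimensional ℚ⟮ζ⟯ ℚ⟮ζ⟯⟮ω⟯ := adjoin.finiteDimensional hω
  have h1 := Module.finrank_mul_finrank ℚ ℚ⟮ζ⟯ ℚ⟮ζ⟯⟮ω⟯
  rw [adjoin.finrank hω, finrank_adjoin_primitiveRoot hm hζ] at h1
  rw [h1, ← finrank_adjoin_primitiveRoot hn hη]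
  have : FiniteDimensional ℚ (ℚ⟮ζ⟯⟮ω⟯.restrictScalars ℚ) :=
    FiniteDimensional.trans ℚ ℚ⟮ζ⟯ ℚ⟮ζ⟯⟮ω⟯
  have hle : ℚ⟮η⟯ ≤ ℚ⟮ζ⟯⟮ω⟯.restrictScalars ℚ := by
    rw [adjoin_simple_le_iff]; exact hmem
  exact finrank_le_of_le_right hle

theorem eq_zero_of_sum_pow_mul_eq_zero {K : IntermediateField ℚ ℂ} {ω : ℂ} {D : ℕ}
    (hD : D ≤ (minpoly K ω).natDegree) {y : ℕ → ℂ} (hy : ∀ i, y i ∈ K)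
    (hsum : ∑ i ∈ Finset.range D, ω ^ i * y i = 0) : ∀ i < D, y i = 0 := by
  have hli := (linearIndependent_pow (K := K) ω).comp (Fin.castLE hD) (Fin.castLE_injective hD)
  rw [Fintype.linearIndependent_iff] at hli
  intro i hi
  have := hli (fun i => ⟨y i, hy i⟩) (by
    rw [← hsum, ← Fin.sum_univ_eq_sum_range (fun i => ω ^ i * y i)]
    refine Finset.sum_congr rfl fun i _ => ?_
    simp [Algebra.smul_def, mul_comm]) ⟨i, hi⟩
  simpa using congrArg Subtype.val this

theorem exists_cosetRep {p m : ℕ} (hp : p.Prime) (hm : m ≠ 0) :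
    ∃ ω : ℂ, IsPrimitiveRoot (ω ^ m) p ∧
      ∀ x : ℕ → ℂ, (∀ i, x i ∈ Algebra.adjoin ℚ {z : ℂ | z ^ m = 1}) →
        ∑ i ∈ Finset.range p, ω ^ i * x i = 0 →
        (∀ i < p, ∀ j < p, x i = x j) ∧ (p ∣ m → ∀ i < p, x i = 0) := by
  have : NeZero m := ⟨hm⟩
  obtain ⟨ζ, hζ⟩ : ∃ ζ : ℂ, IsPrimitiveRoot ζ m := ⟨_, Complex.isPrimitiveRoot_exp m hm⟩
  have hK : ∀ z ∈ Algebra.adjoin ℚ {z : ℂ | z ^ m = 1}, z ∈ ℚ⟮ζ⟯ := by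
    intro z hz
    refine (Algebra.adjoin_le (S := ℚ⟮ζ⟯.toSubalgebra) ?_) hz
    intro z hz
    obtain ⟨i, -, rfl⟩ := hζ.eq_pow_of_pow_eq_one hz
    exact pow_mem (mem_adjoin_simple_self ℚ ζ) i
  have hφ : 0 < m.totient := Nat.totient_pos.2 (Nat.pos_of_ne_zero hm)
  have hpm : p * m ≠ 0 := mul_ne_zero hp.ne_zero hm
  by_cases hdvd : p ∣ m
  · obtain ⟨ω, hω⟩ : ∃ ω : ℂ, IsPrimitiveRoot ω (p * m) :=
      ⟨_, Complex.isPrimitiveRoot_exp _ hpm⟩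
    refine ⟨ω, hω.pow (Nat.pos_of_ne_zero hpm) (mul_comm p m), fun x hx hsum => ?_⟩
    have hint : IsIntegral ℚ⟮ζ⟯ ω := (hω.isIntegral (Nat.pos_of_ne_zero hpm)).tower_top
    have hdeg := totient_le_natDegree_minpoly hm hpm hζ hω hint (mem_adjoin_simple_self _ ω)
    rw [Nat.totient_mul_of_prime_of_dvd hp hdvd, mul_comm] at hdeg
    have h0 := eq_zero_of_sum_pow_mul_eq_zero (Nat.le_of_mul_le_mul_left hdeg hφ)
      (fun i => hK _ (hx i)) hsum
    exact ⟨fun i hi j hj => by rw [h0 i hi, h0 j hj], fun _ => h0⟩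
  · obtain ⟨ω, hω⟩ : ∃ ω : ℂ, IsPrimitiveRoot ω p := ⟨_, Complex.isPrimitiveRoot_exp p hp.ne_zero⟩
    have hcop : Nat.Coprime m p := ((Nat.Prime.coprime_iff_not_dvd hp).2 hdvd).symm
    refine ⟨ω, hω.pow_of_coprime m hcop, fun x hx hsum => ?_⟩
    have hint : IsIntegral ℚ⟮ζ⟯ ω := (hω.isIntegral hp.pos).tower_top
    have hη : IsPrimitiveRoot (ζ * ω) (p * m) := by
      rw [IsPrimitiveRoot.iff_orderOf, (Commute.all ζ ω).orderOf_mul_eq_mul_orderOf_of_coprime,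
        ← hζ.eq_orderOf, ← hω.eq_orderOf, mul_comm]
      rwa [← hζ.eq_orderOf, ← hω.eq_orderOf]
    have hdeg := totient_le_natDegree_minpoly hm hpm hζ hη hint
      (mul_mem (IntermediateField.algebraMap_mem ℚ⟮ζ⟯⟮ω⟯ (⟨ζ, mem_adjoin_simple_self ℚ ζ⟩ : ℚ⟮ζ⟯))
        (mem_adjoin_simple_self _ ω))
    rw [Nat.totient_mul_of_prime_of_not_dvd hp hdvd, mul_comm] at hdeg
    have hp1 : p - 1 + 1 = p := Nat.sub_add_cancel hp.one_le
    have hgeom := hω.geom_sum_eq_zero hp.one_lt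
    have h0 := eq_zero_of_sum_pow_mul_eq_zero (y := fun i => x i - x (p - 1))
      (Nat.le_of_mul_le_mul_left hdeg hφ)
      (fun i => sub_mem (hK _ (hx i)) (hK _ (hx _))) (by
        have : ∑ i ∈ Finset.range p, ω ^ i * (x i - x (p - 1)) = 0 := by
          simp_rw [mul_sub, Finset.sum_sub_distrib, ← Finset.sum_mul, hsum, hgeom]; simp
        rw [← hp1, Finset.sum_range_succ] at this
        simpa using this)
    have h1 : ∀ i < p, x i = x (p - 1) := by
      intro i hi
      rcases (Nat.le_sub_one_of_lt hi).lt_or_eq with h | rfl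
      · exact sub_eq_zero.1 (h0 i h)
      · rfl
    exact ⟨fun i hi j hj => by rw [h1 i hi, h1 j hj], fun h => absurd h hdvd⟩

theorem Multiset.eq_sum_filter_of_existsUnique {α : Type*} {n : ℕ} (P : ℕ → α → Prop)
    [∀ i, DecidablePred (P i)] (A : Multiset α)
    (h : ∀ a ∈ A, ∃ i < n, P i a ∧ ∀ j < n, P j a → j = i) :
    A = ∑ i ∈ Finset.range n, A.filter (P i) := by
  induction A using Multiset.induction_on with
  | empty => simp
  | cons a A ih =>
    obtain ⟨i, hi, hPi, huniq⟩ := h a (Multiset.mem_cons_self a A)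
    have hsum : ∑ j ∈ Finset.range n, (if P j a then {a} else 0 : Multiset α) = {a} := by
      rw [Finset.sum_eq_single i]
      · simp [hPi]
      · intro j hj hji
        rw [if_neg fun hP => hji (huniq j (Finset.mem_range.1 hj) hP)]
      · exact fun hni => absurd (Finset.mem_range.2 hi) hni
    simp_rw [Multiset.filter_cons, Finset.sum_add_distrib]
    rw [hsum, ← ih fun b hb => h b (Multiset.mem_cons_of_mem hb), Multiset.singleton_add]

/-- The elements of `A` in the coset `ω ^ i · μ_m`, translated back into `μ_m`. -/
noncomputable def cosetPart (ω : ℂ) (m : ℕ) (A : Multiset ℂ) (i : ℕ) : Multiset ℂ :=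
  (A.filter fun x => x ^ m = (ω ^ m) ^ i).map fun x => x / ω ^ i

section cosetPart

variable {ω : ℂ} {p m : ℕ} {A : Multiset ℂ}

@[simp] theorem cosetPart_zero (i : ℕ) : cosetPart ω m 0 i = 0 := by simp [cosetPart]

theorem pow_eq_one_of_mem_cosetPart (hω : ω ≠ 0) {i : ℕ} {y : ℂ} (hy : y ∈ cosetPart ω m A i) :
    y ^ m = 1 := by
  obtain ⟨x, hx, rfl⟩ := Multiset.mem_map.1 hy
  rw [div_pow, (Multiset.mem_filter.1 hx).2, pow_right_comm, div_self]
  exact pow_ne_zero _ (pow_ne_zero _ hω)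

theorem eq_sum_map_cosetPart (hω0 : ω ≠ 0) (hω : IsPrimitiveRoot (ω ^ m) p) (hp : p ≠ 0)
    (hA : ∀ x ∈ A, x ^ (p * m) = 1) :
    A = ∑ i ∈ Finset.range p, (cosetPart ω m A i).map (ω ^ i * ·) := by
  have : NeZero p := ⟨hp⟩
  conv_lhs => rw [A.eq_sum_filter_of_existsUnique (n := p) (fun i x => x ^ m = (ω ^ m) ^ i) (by
    intro x hx
    obtain ⟨i, hi, h⟩ := hω.eq_pow_of_pow_eq_one (ξ := x ^ m) (by
      rw [← pow_mul, mul_comm, hA x hx])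
    exact ⟨i, hi, h.symm, fun j hj h' => hω.pow_inj hj hi (h'.symm.trans h.symm)⟩)]
  refine Finset.sum_congr rfl fun i _ => ?_
  have : ∀ x : ℂ, ω ^ i * (x / ω ^ i) = x := fun x => mul_div_cancel₀ x (pow_ne_zero _ hω0)
  simp [cosetPart, Multiset.map_map, this]

theorem card_eq_sum_card_cosetPart (hω0 : ω ≠ 0) (hω : IsPrimitiveRoot (ω ^ m) p) (hp : p ≠ 0)
    (hA : ∀ x ∈ A, x ^ (p * m) = 1) :
    A.card = ∑ i ∈ Finset.range p, (cosetPart ω m A i).card := by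
  conv_lhs => rw [eq_sum_map_cosetPart hω0 hω hp hA]
  simp

theorem sum_eq_sum_sum_cosetPart (hω0 : ω ≠ 0) (hω : IsPrimitiveRoot (ω ^ m) p) (hp : p ≠ 0)
    (hA : ∀ x ∈ A, x ^ (p * m) = 1) :
    A.sum = ∑ i ∈ Finset.range p, ω ^ i * (cosetPart ω m A i).sum := by
  conv_lhs => rw [eq_sum_map_cosetPart hω0 hω hp hA]
  rw [Multiset.sum_sum]
  refine Finset.sum_congr rfl fun i _ => ?_
  rw [Multiset.sum_map_mul_left, Multiset.map_id']

end cosetPart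

theorem exists_cosetPart_sum_sub_sum_eq {p m : ℕ} (hp : p.Prime) (hm : m ≠ 0) :
    ∃ ω : ℂ, ω ≠ 0 ∧ IsPrimitiveRoot (ω ^ m) p ∧ ∀ A B : Multiset ℂ,
      (∀ x ∈ A, x ^ (p * m) = 1) → (∀ x ∈ B, x ^ (p * m) = 1) → A.sum = B.sum →
      (∀ i < p, ∀ j < p, (cosetPart ω m A i).sum - (cosetPart ω m B i).sum =
        (cosetPart ω m A j).sum - (cosetPart ω m B j).sum) ∧
      (p ∣ m → ∀ i < p, (cosetPart ω m A i).sum = (cosetPart ω m B i).sum) := by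
  obtain ⟨ω, hω, h⟩ := exists_cosetRep hp hm
  have hω0 : ω ≠ 0 := by
    rintro rfl
    rw [zero_pow hm] at hω
    exact hω.ne_zero hp.ne_zero rfl
  refine ⟨ω, hω0, hω, fun A B hA hB hAB => ?_⟩
  have hmem : ∀ (C : Multiset ℂ) (i : ℕ),
      (cosetPart ω m C i).sum ∈ Algebra.adjoin ℚ {z : ℂ | z ^ m = 1} := fun C i =>
    multiset_sum_mem _ fun y hy =>
      Algebra.subset_adjoin (pow_eq_one_of_mem_cosetPart hω0 hy)
  obtain ⟨h1, h2⟩ := h (fun i => (cosetPart ω m A i).sum - (cosetPart ω m B i).sum)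
    (fun i => sub_mem (hmem A i) (hmem B i)) (by
      simp_rw [mul_sub, Finset.sum_sub_distrib]
      rw [← sum_eq_sum_sum_cosetPart hω0 hω hp.ne_zero hA,
        ← sum_eq_sum_sum_cosetPart hω0 hω hp.ne_zero hB, hAB, sub_self])
  exact ⟨h1, fun hd i hi => sub_eq_zero.1 (h2 hd i hi)⟩

theorem sum_filter_pow_eq_of_sum_eq_zero {n : ℕ} (m : ℕ) (hm : m ≠ 0) : ∀ A : Multiset ℂ,
    (∀ x ∈ A, x ^ m = 1) → A.card ≤ n → A.sum = 0 →
    ∀ c : ℂ, (A.filter fun x => x ^ n.factorial = c).sum = 0 := by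
  induction m using Nat.strong_induction_on with
  | _ m ih =>
  intro A hA hcard hsum c
  by_cases hex : ∃ p m', p.Prime ∧ m = p * m' ∧ (p ∣ m' ∨ n < p)
  · obtain ⟨p, m', hp, rfl, hpn⟩ := hex
    have hm' : m' ≠ 0 := right_ne_zero_of_mul hm
    obtain ⟨ω, hω0, hω, h⟩ := exists_cosetPart_sum_sub_sum_eq hp hm'
    obtain ⟨h1, h2⟩ := h A 0 hA (by simp) (by simpa using hsum)
    simp only [cosetPart_zero, Multiset.sum_zero, sub_zero] at h1 h2
    have hcardA := card_eq_sum_card_cosetPart hω0 hω hp.ne_zero hA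
    have hzero : ∀ i < p, (cosetPart ω m' A i).sum = 0 := by
      rcases hpn with hd | hlt
      · exact h2 hd
      · obtain ⟨j, hj, hj0⟩ : ∃ j ∈ Finset.range p, (cosetPart ω m' A j).card < 1 := by
          refine Finset.exists_lt_of_sum_lt ?_
          rw [← hcardA]
          simpa using hcard.trans_lt hlt
        rw [Nat.lt_one_iff, Multiset.card_eq_zero] at hj0
        intro i hi
        rw [h1 i hi j (Finset.mem_range.1 hj), hj0, Multiset.sum_zero]
    have hfilter : ∀ (T : Finset ℕ) (F : ℕ → Multiset ℂ) (P : ℂ → Prop) [DecidablePred P],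
        (∑ i ∈ T, F i).filter P = ∑ i ∈ T, (F i).filter P := by
      intro T F P _
      induction T using Finset.induction_on with
      | empty => simp
      | insert a T ha ih => simp [Finset.sum_insert ha, ih]
    rw [eq_sum_map_cosetPart hω0 hω hp.ne_zero hA, hfilter, Multiset.sum_sum]
    refine Finset.sum_eq_zero fun i hi => ?_
    have hi' := Finset.mem_range.1 hi
    rw [Multiset.filter_map, Multiset.sum_map_mul_left, Multiset.map_id']
    have hle : (cosetPart ω m' A i).card ≤ n := by
      refine le_trans ?_ hcard
      rw [hcardA]
      exact Finset.single_le_sum (f := fun i => (cosetPart ω m' A i).card)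
        (fun _ _ => Nat.zero_le _) hi
    have := ih m' (by nlinarith [hp.two_le, Nat.pos_of_ne_zero hm']) hm' (cosetPart ω m' A i)
      (fun y => pow_eq_one_of_mem_cosetPart hω0) hle (hzero i hi')
      (c / (ω ^ i) ^ n.factorial)
    rw [Multiset.filter_congr (q := fun y => y ^ n.factorial = c / (ω ^ i) ^ n.factorial), this,
      mul_zero]
    intro y _
    simp only [Function.comp]
    rw [mul_pow, eq_div_iff (pow_ne_zero _ (pow_ne_zero _ hω0)), mul_comm]
  · push Not at hex
    have hdvd : m ∣ n.factorial := by
      have hsq : Squarefree m := by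
        rw [Nat.squarefree_iff_prime_squarefree]
        rintro p hp ⟨k, hk⟩
        exact (hex p (p * k) hp (by rw [hk, mul_assoc])).1 (dvd_mul_right p k)
      rw [← Nat.prod_primeFactors_of_squarefree hsq]
      refine Finset.prod_primes_dvd _ (fun p hp => (Nat.prime_of_mem_primeFactors hp).prime)
        fun p hp => ?_
      have hp' := Nat.prime_of_mem_primeFactors hp
      obtain ⟨k, hk⟩ := Nat.dvd_of_mem_primeFactors hp
      exact Nat.dvd_factorial hp'.pos (hex p k hp' hk).2
    have hone : ∀ x ∈ A, x ^ n.factorial = 1 := by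
      intro x hx
      obtain ⟨k, hk⟩ := hdvd
      rw [hk, pow_mul, hA x hx, one_pow]
    by_cases hc : c = 1
    · rw [Multiset.filter_eq_self.2 fun x hx => by rw [hone x hx, hc], hsum]
    · rw [Multiset.filter_eq_nil.2 fun x hx h => hc (by rw [← h, hone x hx]), Multiset.sum_zero]

theorem exists_intPolynomial_sum_card {m : ℕ} (hm : m ≠ 0) {ζ : ℂ} (hζ : IsPrimitiveRoot ζ m)
    (A : Multiset ℂ) (hA : ∀ x ∈ A, x ^ m = 1) :
    ∃ F : ℤ[X], aeval ζ F = A.sum ∧ F.eval 1 = A.card := by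
  have : NeZero m := ⟨hm⟩
  induction A using Multiset.induction_on with
  | empty => exact ⟨0, by simp⟩
  | cons a A ih =>
    obtain ⟨F, h1, h2⟩ := ih fun x hx => hA x (Multiset.mem_cons_of_mem hx)
    obtain ⟨i, -, hi⟩ := hζ.eq_pow_of_pow_eq_one (hA a (Multiset.mem_cons_self a A))
    exact ⟨X ^ i + F, by simp [h1, hi], by simp [h2, add_comm]⟩

theorem card_modEq_of_sum_eq {q a : ℕ} (hq : q.Prime) {A B : Multiset ℂ}
    (hA : ∀ x ∈ A, x ^ q ^ a = 1) (hB : ∀ x ∈ B, x ^ q ^ a = 1) (hsum : A.sum = B.sum) :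
    (q : ℤ) ∣ (A.card : ℤ) - B.card := by
  have : Fact q.Prime := ⟨hq⟩
  have hm : q ^ a ≠ 0 := pow_ne_zero _ hq.ne_zero
  obtain ⟨ζ, hζ⟩ : ∃ ζ : ℂ, IsPrimitiveRoot ζ (q ^ a) := ⟨_, Complex.isPrimitiveRoot_exp _ hm⟩
  obtain ⟨F, hF1, hF2⟩ := exists_intPolynomial_sum_card hm hζ A hA
  obtain ⟨G, hG1, hG2⟩ := exists_intPolynomial_sum_card hm hζ B hB
  have hdvd : cyclotomic (q ^ a) ℤ ∣ F - G := by
    rw [cyclotomic_eq_minpoly hζ (Nat.pos_of_ne_zero hm)]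
    exact minpoly.isIntegrallyClosed_dvd (hζ.isIntegral (Nat.pos_of_ne_zero hm))
      (by rw [map_sub, hF1, hG1, hsum, sub_self])
  have hev := eval_dvd (x := 1) hdvd
  rw [eval_sub, hF2, hG2] at hev
  refine dvd_trans ?_ hev
  cases a with
  | zero => simp
  | succ a => rw [eval_one_cyclotomic_prime_pow]

theorem sum_lower_bound_of_shifts (S : AddSubmonoid ℕ) {q₁ q₂ p : ℕ} (hq : q₁ ≤ q₂)
    (hqp : q₂ ≤ p) (hlt : q₁ < p) (hpS : p ∈ S) (n t : ℕ → ℕ)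
    (ht : ∑ i ∈ Finset.range p, t i < q₁)
    (h : ∀ i < p, ∀ j < p, t j = 0 → t i + n j < q₁ →
      (∃ s ∈ S, n i = t i + n j + s) ∨ (q₁ - (t i + n j)) * (q₂ - 1) ≤ n i) :
    (∃ s ∈ S, ∑ i ∈ Finset.range p, n i = ∑ i ∈ Finset.range p, t i + s) ∨
      (q₁ - ∑ i ∈ Finset.range p, t i) * (q₂ - 1) ≤ ∑ i ∈ Finset.range p, n i := by
  obtain ⟨j₀, hj₀, hj₀t⟩ : ∃ j ∈ Finset.range p, t j < 1 := by
    refine Finset.exists_lt_of_sum_lt ?_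
    simpa using ht.trans hlt
  obtain ⟨j, hj, hmin⟩ := Finset.exists_min_image ((Finset.range p).filter fun j => t j = 0) n
    ⟨j₀, by simpa using ⟨Finset.mem_range.1 hj₀, Nat.lt_one_iff.1 hj₀t⟩⟩
  simp only [Finset.mem_filter, Finset.mem_range] at hj hmin
  obtain ⟨hjp, hjt⟩ := hj
  by_cases hall : ∀ i < p, ∃ s ∈ S, n i = t i + n j + s
  · left
    choose! s hsS hs using hall
    refine ⟨p • n j + ∑ i ∈ Finset.range p, s i, S.add_mem ?_ ?_, ?_⟩
    · rw [smul_eq_mul, mul_comm]; exact S.nsmul_mem hpS (n j)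
    · exact S.sum_mem fun i hi => hsS i (Finset.mem_range.1 hi)
    · rw [Finset.sum_congr rfl fun i hi => hs i (Finset.mem_range.1 hi)]
      simp [Finset.sum_add_distrib, add_assoc]
  · right
    push Not at hall
    obtain ⟨i, hip, hi⟩ := hall
    have hi' : t i + n j < q₁ → (q₁ - (t i + n j)) * (q₂ - 1) ≤ n i := fun hlt' =>
      (h i hip j hjp hjt hlt').resolve_left fun ⟨s, hs, e⟩ => hi s hs e
    have himem : i ∈ Finset.range p := Finset.mem_range.2 hip
    have hrest : (p - 1) * n j ≤ ∑ k ∈ (Finset.range p).erase i, (n k + n j * t k) := by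
      have := Finset.card_nsmul_le_sum ((Finset.range p).erase i) (fun k => n k + n j * t k) (n j)
        (by
          intro k hk
          have hkp := Finset.mem_range.1 (Finset.mem_of_mem_erase hk)
          rcases Nat.eq_zero_or_pos (t k) with h0 | h0
          · exact (hmin k ⟨hkp, h0⟩).trans (Nat.le_add_right _ _)
          · exact (Nat.le_mul_of_pos_right _ h0).trans (Nat.le_add_left _ _))
      simpa [Finset.card_erase_of_mem himem] using this
    rw [Finset.sum_add_distrib, ← Finset.mul_sum] at hrest
    rw [← Finset.add_sum_erase _ n himem]
    rw [← Finset.add_sum_erase _ t himem] at ht ⊢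
    generalize ∑ k ∈ (Finset.range p).erase i, n k = T at *
    generalize ∑ k ∈ (Finset.range p).erase i, t k = u at *
    generalize n j = s at *
    generalize n i = x at *
    generalize t i = v at *
    obtain ⟨a, rfl⟩ : ∃ a, q₁ = v + u + a + 1 := Nat.exists_eq_add_of_lt ht
    obtain ⟨b, rfl⟩ : ∃ b, q₂ = v + u + a + 1 + b := Nat.exists_eq_add_of_le hq
    obtain ⟨c, rfl⟩ : ∃ c, p = v + u + a + 1 + b + c := Nat.exists_eq_add_of_le hqp
    have e1 : v + u + a + 1 - (v + u) = a + 1 := by omega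
    have e2 : v + u + a + 1 + b - 1 = v + u + a + b := by omega
    have e3 : v + u + a + 1 + b + c - 1 = v + u + a + b + c := by omega
    rw [e1, e2]
    rw [e2] at hi'
    rw [e3] at hrest
    rcases lt_or_ge (v + s) (v + u + a + 1) with hs | hs
    · have hx := hi' hs
      obtain ⟨r, hr⟩ : ∃ r, u + a = s + r := Nat.exists_eq_add_of_le (by omega)
      have e4 : v + u + a + 1 - (v + s) = r + 1 := by omega
      rw [e4] at hx
      have hv : 0 ≤ u * (v + r + b) + s * c := Nat.zero_le _
      zify at hx hr hrest hv ⊢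
      have hr' : (r : ℤ) = u + a - s := by linarith
      rw [hr'] at hx hv
      linarith
    · obtain ⟨r, rfl⟩ : ∃ r, s = u + a + 1 + r := Nat.exists_eq_add_of_le (by omega)
      have hbc : 1 ≤ b + c := by omega
      zify at hrest hbc ⊢
      nlinarith

theorem exists_card_eq_add_or_le_card (S : AddSubmonoid ℕ) {q₁ q₂ : ℕ} (hq₁ : q₁.Prime)
    (hq : q₁ < q₂) (hq₁S : q₁ ∈ S) (m : ℕ) (hm : m ≠ 0) : (∀ p, p.Prime → p ∣ m → p ∈ S) →
    (∀ p, p.Prime → p ∣ m → p = q₁ ∨ q₂ ≤ p) → ∀ A B : Multiset ℂ,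
    (∀ x ∈ A, x ^ m = 1) → (∀ x ∈ B, x ^ m = 1) → A.sum = B.sum → B.card < q₁ →
    (∃ s ∈ S, A.card = B.card + s) ∨ (q₁ - B.card) * (q₂ - 1) ≤ A.card := by
  induction m using Nat.strong_induction_on with
  | _ m ih =>
  intro hS hprimes A B hA hB hsum hcard
  by_cases hex : ∃ p, p.Prime ∧ p ∣ m ∧ p ≠ q₁
  · obtain ⟨p, hp, ⟨m', rfl⟩, hpq⟩ := hex
    have hm' : m' ≠ 0 := right_ne_zero_of_mul hm
    have hqp : q₂ ≤ p := (hprimes p hp (dvd_mul_right p m')).resolve_left hpq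
    obtain ⟨ω, hω0, hω, h⟩ := exists_cosetPart_sum_sub_sum_eq hp hm'
    have hparts := (h A B hA hB hsum).1
    have hcardA := card_eq_sum_card_cosetPart hω0 hω hp.ne_zero hA
    have hcardB := card_eq_sum_card_cosetPart hω0 hω hp.ne_zero hB
    rw [hcardB] at hcard
    rw [hcardA, hcardB]
    refine sum_lower_bound_of_shifts S hq.le hqp (hq.trans_le hqp) (hS p hp (dvd_mul_right p m'))
      _ _ hcard fun i hi j hj hj0 hlt => ?_
    have := ih m' (by nlinarith [hp.two_le, Nat.pos_of_ne_zero hm']) hm'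
      (fun r hr hd => hS r hr (hd.mul_left p)) (fun r hr hd => hprimes r hr (hd.mul_left p))
      (cosetPart ω m' A i) (cosetPart ω m' B i + cosetPart ω m' A j)
      (fun y => pow_eq_one_of_mem_cosetPart hω0)
      (fun y hy => (Multiset.mem_add.1 hy).elim (pow_eq_one_of_mem_cosetPart hω0)
        (pow_eq_one_of_mem_cosetPart hω0)) (by
        have := hparts i hi j hj
        rw [Multiset.card_eq_zero.1 hj0, Multiset.sum_zero, sub_zero, sub_eq_iff_eq_add] at this
        rw [this, Multiset.sum_add, add_comm])
    rw [Multiset.card_add] at this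
    exact this hlt
  · push Not at hex
    left
    obtain ⟨a, rfl⟩ : ∃ a, m = q₁ ^ a :=
      ⟨_, Nat.eq_prime_pow_of_unique_prime_dvd hm fun {d} hd hdm => hex d hd hdm⟩
    obtain ⟨k, hk⟩ := card_modEq_of_sum_eq hq₁ hA hB hsum
    have hk0 : 0 ≤ k := by
      by_contra! hneg
      have : (q₁ : ℤ) * k ≤ q₁ * (-1) :=
        mul_le_mul_of_nonneg_left (by omega) (Int.natCast_nonneg _)
      omega
    lift k to ℕ using hk0
    refine ⟨k * q₁, S.nsmul_mem hq₁S k, ?_⟩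
    zify
    linarith

/-- **Lam–Leung**: the length of a vanishing sum of `N`-th roots of unity is a sum of prime
divisors of `N`. -/
theorem card_mem_closure_primeFactors_of_sum_eq_zero {N : ℕ} (hN : N ≠ 0) {A : Multiset ℂ}
    (hA : ∀ x ∈ A, x ^ N = 1) (hsum : A.sum = 0) :
    A.card ∈ AddSubmonoid.closure (N.primeFactors : Set ℕ) := by
  rcases eq_or_ne N 1 with rfl | hN1
  · have hA1 : A = Multiset.replicate A.card 1 :=
      Multiset.eq_replicate.2 ⟨rfl, fun x hx => by simpa using hA x hx⟩
    rw [hA1] at hsum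
    have : A.card = 0 := by simpa using hsum
    rw [this]
    exact zero_mem _
  have hmem : ∀ p, p.Prime → p ∣ N → p ∈ AddSubmonoid.closure (N.primeFactors : Set ℕ) :=
    fun p hp hd => AddSubmonoid.subset_closure (Nat.mem_primeFactors.2 ⟨hp, hd, hN⟩)
  have hq₁ := Nat.minFac_prime hN1
  have hq₁d := Nat.minFac_dvd N
  set q₁ := N.minFac with hq₁def
  obtain ⟨q₂, hlt, hprimes, hq₂⟩ : ∃ q₂, q₁ < q₂ ∧
      (∀ p, p.Prime → p ∣ N → p = q₁ ∨ q₂ ≤ p) ∧ ((q₂.Prime ∧ q₂ ∣ N) ∨ A.card < q₂ - 1) := by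
    by_cases hex : ∃ p, p.Prime ∧ p ∣ N ∧ p ≠ q₁
    · classical
      obtain ⟨hp, hd, hne⟩ := Nat.find_spec hex
      refine ⟨Nat.find hex, lt_of_le_of_ne (Nat.minFac_le_of_dvd hp.two_le hd) hne.symm,
        fun p hp hd => ?_, Or.inl ⟨hp, hd⟩⟩
      by_cases h : p = q₁
      · exact Or.inl h
      · exact Or.inr (Nat.find_min' hex ⟨hp, hd, h⟩)
    · push Not at hex
      exact ⟨q₁ + A.card + 2, by omega, fun p hp hd => Or.inl (hex p hp hd), Or.inr (by omega)⟩
  rcases exists_card_eq_add_or_le_card _ hq₁ hlt (hmem q₁ hq₁ hq₁d) N hN hmem hprimes A 0 hA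
    (by simp) (by simpa using hsum) (by simpa using hq₁.pos) with ⟨s, hs, he⟩ | hle
  · rw [he]; simpa using hs
  · simp only [Multiset.card_zero, Nat.sub_zero] at hle
    rcases hq₂ with ⟨hq₂, hq₂d⟩ | hsmall
    · have hfrob := frobeniusNumber_pair ((Nat.coprime_primes hq₁ hq₂).2 hlt.ne) hq₁.one_lt
        hq₂.one_lt
      by_contra hnot
      have hle' : A.card ≤ q₁ * q₂ - q₁ - q₂ := hfrob.2 fun hin => hnot <|
        AddSubmonoid.closure_mono (by
          rintro x (rfl | rfl)
          · exact Nat.mem_primeFactors.2 ⟨hq₁, hq₁d, hN⟩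
          · exact Nat.mem_primeFactors.2 ⟨hq₂, hq₂d, hN⟩) hin
      rw [Nat.mul_sub_one] at hle
      have : q₁ + q₂ ≤ q₁ * q₂ := by nlinarith [hq₁.two_le, hq₂.two_le]
      have := hq₂.two_le
      omega
    · exact absurd (hle.trans_lt hsmall) (not_lt.2 (Nat.le_mul_of_pos_left _ hq₁.pos))

theorem exists_coeff_of_mem_closure {s : Finset ℕ} {n : ℕ}
    (hn : n ∈ AddSubmonoid.closure (s : Set ℕ)) : ∃ b : ℕ → ℕ, n = ∑ p ∈ s, b p * p := by
  induction hn using AddSubmonoid.closure_induction with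
  | mem x hx =>
    exact ⟨fun p => if p = x then 1 else 0, by simp [Finset.mem_coe.1 hx]⟩
  | zero => exact ⟨0, by simp⟩
  | add x y _ _ hx hy =>
    obtain ⟨b, hb⟩ := hx
    obtain ⟨c, hc⟩ := hy
    exact ⟨b + c, by simp [hb, hc, add_mul, Finset.sum_add_distrib]⟩

theorem mem_IZeroSet_of_vanishing {N d : ℕ} (hN : N ≠ 0) (hd : 0 < d) {A B : Multiset ℂ}
    (hA : ∀ x ∈ A, x ^ N = 1) (hB : ∀ x ∈ B, x ^ N = 1) (hAsum : A.sum = 0) (hBsum : B.sum = 0)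
    (hA0 : A ≠ 0) (hcard : 2 * d = 2 * A.card + B.card) : d ∈ IZeroSet N := by
  obtain ⟨b, hb⟩ := exists_coeff_of_mem_closure
    (card_mem_closure_primeFactors_of_sum_eq_zero hN hA hAsum)
  obtain ⟨c, hc⟩ := exists_coeff_of_mem_closure
    (card_mem_closure_primeFactors_of_sum_eq_zero hN hB hBsum)
  refine ⟨hd, fun p => 2 * b p + c p, ?_, ?_⟩
  · rw [hcard, hb, hc, Finset.mul_sum, ← Finset.sum_add_distrib]
    exact Finset.sum_congr rfl fun p _ => by ring
  · obtain ⟨p, hp, hne⟩ := Finset.exists_ne_zero_of_sum_ne_zero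
      (hb ▸ (Multiset.card_pos.2 hA0).ne')
    have := Nat.pos_of_ne_zero (left_ne_zero_of_mul hne)
    exact ⟨p, hp, by dsimp only; omega⟩

theorem pow_two_mul_factorial_eq_one {N d : ℕ} (hN : N ≠ 0) (hd : 0 < d) (hdN : d ∉ IZeroSet N)
    {f : Fin d → ℂ} (hf : ∀ j, f j ^ N = 1) (hsum : ∑ j, (f j + (f j)⁻¹) = 0) (j : Fin d) :
    f j ^ (2 * (2 * d).factorial) = 1 := by
  by_contra hj
  have hf0 : ∀ j, f j ≠ 0 := fun j h => by
    have := hf j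
    rw [h, zero_pow hN] at this
    exact zero_ne_one this
  set P := (2 * d).factorial with hP
  set U : Multiset ℂ := Finset.univ.val.map f with hU
  set M : Multiset ℂ := U + U.map (·⁻¹) with hM
  have hMroot : ∀ x ∈ M, x ^ N = 1 := by
    intro x hx
    simp only [hM, hU, Multiset.mem_add, Multiset.mem_map] at hx
    rcases hx with ⟨j, -, rfl⟩ | ⟨_, ⟨j, -, rfl⟩, rfl⟩
    · exact hf j
    · rw [inv_pow, hf j, inv_one]
  have hMcard : M.card = 2 * d := by simp [hM, hU, two_mul]
  have hMsum : M.sum = 0 := by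
    rw [← hsum, Finset.sum_add_distrib]
    rw [hM, hU, Multiset.sum_add, Multiset.map_map]
    rfl
  have hMinv : M.map (·⁻¹) = M := by
    simp [hM, Multiset.map_map, add_comm]
  have hzero := sum_filter_pow_eq_of_sum_eq_zero N hN M hMroot hMcard.le hMsum
  rw [← hP] at hzero
  set c := f j ^ P with hc
  have hcc : c ≠ c⁻¹ := by
    intro h
    refine hj ?_
    rw [mul_comm, pow_mul, ← hc, sq]
    nth_rewrite 2 [h]
    exact mul_inv_cancel₀ (pow_ne_zero _ (hf0 j))
  have hcard_inv : (M.filter fun x => x ^ P = c⁻¹).card = (M.filter fun x => x ^ P = c).card := by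
    conv_lhs => rw [← hMinv]
    rw [Multiset.filter_map, Multiset.card_map]
    congr 1
    refine Multiset.filter_congr fun x _ => ?_
    simp [inv_pow]
  set R := (M.filter fun x => ¬ x ^ P = c).filter fun x => ¬ x ^ P = c⁻¹ with hR
  have hdecomp : (M.filter fun x => x ^ P = c) + ((M.filter fun x => x ^ P = c⁻¹) + R) = M := by
    have h1 : (M.filter fun x => x ^ P = c⁻¹) =
        (M.filter fun x => ¬ x ^ P = c).filter fun x => x ^ P = c⁻¹ := by
      rw [Multiset.filter_filter]
      exact Multiset.filter_congr fun x _ => ⟨fun h => ⟨h, by rw [h]; exact hcc.symm⟩, And.left⟩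
    rw [h1, hR, Multiset.filter_add_not, Multiset.filter_add_not]
  refine hdN (mem_IZeroSet_of_vanishing hN hd (A := M.filter fun x => x ^ P = c) (B := R)
    (fun x hx => hMroot x (Multiset.mem_of_mem_filter hx))
    (fun x hx => hMroot x (Multiset.mem_of_mem_filter (Multiset.mem_of_mem_filter hx)))
    (hzero c) ?_ ?_ ?_)
  · have := congrArg Multiset.sum hdecomp
    simpa [hzero, hMsum] using this
  · refine fun h => Multiset.eq_zero_iff_forall_notMem.1 h (f j)
      (Multiset.mem_filter.2 ⟨?_, hc.symm⟩)
    exact Multiset.mem_add.2 (Or.inl (Multiset.mem_map_of_mem f (Finset.mem_univ j)))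
  · have := congrArg Multiset.card hdecomp
    rw [Multiset.card_add, Multiset.card_add, hcard_inv, hMcard] at this
    omega

theorem zero_mult_bounded_of_not_mem_IZeroSet (d : ℕ) (hd : 1 ≤ d) :
    ∃ C : ℕ, 0 < C ∧ ∀ N : ℕ, 3 ≤ N → 1 ≤ torusMult N d 0 → d ∉ IZeroSet N →
      torusMult N d 0 ≤ C := by
  have hQ : 0 < 2 * (2 * d).factorial := Nat.mul_pos two_pos (Nat.factorial_pos _)
  refine ⟨(2 * (2 * d).factorial) ^ d, pow_pos hQ d, fun N hN _ hdN => ?_⟩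
  have hN0 : N ≠ 0 := by omega
  have hζ := Complex.isPrimitiveRoot_exp N hN0
  set ζ := Complex.exp (2 * Real.pi * Complex.I / N) with hζdef
  have hcos : ∀ i : ℕ, ((2 * Real.cos (2 * Real.pi * i / N) : ℝ) : ℂ) = ζ ^ i + (ζ ^ i)⁻¹ := by
    intro i
    rw [hζdef, ← Complex.exp_nat_mul, ← Complex.exp_neg]
    push_cast
    rw [Complex.two_cos]
    congr 2 <;> ring
  let R := Polynomial.nthRootsFinset (2 * (2 * d).factorial) (1 : ℂ)
  let F : {k : Fin d → Fin N // (∑ j, 2 * Real.cos (2 * Real.pi * (k j : ℝ) / N)) = 0} →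
      (Fin d → R) := fun k j => ⟨ζ ^ (k.1 j : ℕ), by
    rw [Polynomial.mem_nthRootsFinset hQ]
    refine pow_two_mul_factorial_eq_one hN0 hd hdN (f := fun j => ζ ^ (k.1 j : ℕ))
      (fun j => ?_) ?_ j
    · rw [pow_right_comm, hζ.pow_eq_one, one_pow]
    · have := congrArg (fun x : ℝ => (x : ℂ)) k.2
      simp only [Complex.ofReal_sum, hcos, Complex.ofReal_zero] at this
      exact this⟩
  have hF : Function.Injective F := by
    intro k l hkl
    refine Subtype.ext (funext fun j => Fin.ext ?_)
    have := congrArg Subtype.val (congrFun hkl j)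
    exact hζ.pow_inj (k.1 j).2 (l.1 j).2 this
  calc torusMult N d 0 ≤ Nat.card (Fin d → R) := Nat.card_le_card_of_injective F hF
    _ = R.card ^ d := by simp
    _ ≤ _ := Nat.pow_le_pow_left (by
      exact (Complex.isPrimitiveRoot_exp _ hQ.ne').card_nthRootsFinset.le) d
end

section
/- For every integer d ≥ 1 there exist constants c with 0 < c ≤ 1/2 and C > 0, both depending only on d, such that for every integer N ≥ 3 and every eigenvalue μ of the discrete torus T^d_N the following holds: if the number of tuples (k_1,…,k_d) ∈ {0,1,…,N−1}^d with Σ_{j=1}^d 2·cos(2πk_j/N) > μ is less than c·N^d, or the number of tuples (k_1,…,k_d) ∈ {0,1,…,N−1}^d with Σ_{j=1}^d 2·cos(2πk_j/N) < μ is less than c·N^d, then m_{T^d_N}(μ) ≤ C. (Equivalently, listing the N^d eigenvalues of T^d_N in decreasing order as μ_1 ≥ μ_2 ≥ … ≥ μ_{N^d}, the multiplicity of μ_k is at most C whenever k ∈ [1, cN^d) ∪ ((1−c)N^d, N^d].) -/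
/-- The number of tuples whose eigenvalue sum is strictly greater than `μ`. -/
noncomputable def torusCountGT (N d : ℕ) (μ : ℝ) : ℕ :=
  Nat.card {k : Fin d → Fin N //
    μ < ∑ j, 2 * Real.cos (2 * Real.pi * (k j : ℝ) / N)}

/-- The number of tuples whose eigenvalue sum is strictly less than `μ`. -/
noncomputable def torusCountLT (N d : ℕ) (μ : ℝ) : ℕ :=
  Nat.card {k : Fin d → Fin N //
    (∑ j, 2 * Real.cos (2 * Real.pi * (k j : ℝ) / N)) < μ}

open Polynomial in
/-- Galois conjugation of an integral relation between `N`-th roots of unity. -/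
theorem sum_intCast_mul_pow_eq_zero_of_coprime {ι : Type*} [Fintype ι] {N : ℕ} (hN : N ≠ 0)
    {c : ι → ℤ} {z : ι → ℂ} (hz : ∀ i, z i ^ N = 1) (hsum : ∑ i, (c i : ℂ) * z i = 0)
    {a : ℕ} (ha : a.Coprime N) : ∑ i, (c i : ℂ) * z i ^ a = 0 := by
  have : NeZero N := ⟨hN⟩
  have hζ := Complex.isPrimitiveRoot_exp N hN
  set ζ := Complex.exp (2 * Real.pi * Complex.I / N)
  choose e _ he using fun i => hζ.eq_pow_of_pow_eq_one (hz i)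
  let P : ℤ[X] := ∑ i, C (c i) * X ^ e i
  have hP (x : ℂ) : aeval x P = ∑ i, (c i : ℂ) * x ^ e i := by simp [P]
  have hint : IsIntegral ℤ ζ := hζ.isIntegral (Nat.pos_of_ne_zero hN)
  have hdvd : minpoly ℤ ζ ∣ P :=
    minpoly.isIntegrallyClosed_dvd hint (by simpa [hP, he] using hsum)
  rw [hζ.minpoly_eq_pow_coprime ha] at hdvd
  have h0 : aeval (ζ ^ a) P = 0 := aeval_eq_zero_of_dvd_aeval_eq_zero hdvd (minpoly.aeval _ _)
  rw [hP] at h0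
  rw [← h0]
  refine Finset.sum_congr rfl fun i _ => ?_
  rw [← he i, pow_right_comm]

theorem exists_forall_coprime_add_mul_factorial (l N : ℕ) (hN : N ≠ 0) :
    ∃ a : ℕ, ∀ j < l, (a + j * l.factorial).Coprime N := by
  obtain ⟨a, ha⟩ := Nat.chineseRemainderOfFinset (fun p => if p ≤ l then 1 else l.factorial) id
    N.primeFactors (fun p hp => (Nat.prime_of_mem_primeFactors hp).ne_zero)
    (fun p hp q hq hpq => (Nat.coprime_primes (Nat.prime_of_mem_primeFactors hp)
      (Nat.prime_of_mem_primeFactors hq)).2 hpq)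
  refine ⟨a, fun j hj => Nat.coprime_of_dvd fun p hp hpa hpN => ?_⟩
  have hmod := ha p (Nat.mem_primeFactors.2 ⟨hp, hpN, hN⟩)
  simp only [id] at hmod
  have h0 := (hmod.add_right (j * l.factorial)).symm.trans (Nat.modEq_zero_iff_dvd.2 hpa)
  rw [Nat.modEq_zero_iff_dvd] at h0
  split_ifs at h0 with hpl
  · have hpf : p ∣ j * l.factorial := (hp.dvd_factorial.2 hpl).mul_left j
    exact hp.one_lt.ne' (Nat.dvd_one.1 ((Nat.dvd_add_left hpf).1 h0))
  · rw [show l.factorial + j * l.factorial = (j + 1) * l.factorial by ring, hp.dvd_mul,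
      hp.dvd_factorial] at h0
    rcases h0 with h0 | h0
    · have := Nat.le_of_dvd (Nat.succ_pos j) h0
      omega
    · exact hpl h0

open Polynomial in
/-- A relation of length at most `l` between roots of unity on which `x ↦ x ^ l!` is injective is
trivial. -/
theorem sum_filter_eq_zero_of_injOn_pow_factorial {ι : Type*} [Fintype ι] {N l : ℕ} (hN : N ≠ 0)
    (hl : Fintype.card ι ≤ l) {c : ι → ℤ} {z : ι → ℂ} (hz : ∀ i, z i ^ N = 1)
    (hinj : ∀ i j, z i ^ l.factorial = z j ^ l.factorial → z i = z j)
    (hsum : ∑ i, (c i : ℂ) * z i = 0) (w : ℂ) : ∑ i with z i = w, c i = 0 := by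
  by_cases hw : ∃ t, z t = w
  swap
  · rw [Finset.filter_false_of_mem fun i _ hi => hw ⟨i, hi⟩, Finset.sum_empty]
  obtain ⟨t, rfl⟩ := hw
  obtain ⟨a, ha⟩ := exists_forall_coprime_add_mul_factorial l N hN
  have hQ (Q : ℂ[X]) (hdeg : Q.natDegree < l) :
      ∑ i, (c i : ℂ) * z i ^ a * Q.eval (z i ^ l.factorial) = 0 := by
    simp_rw [eval_eq_sum_range' hdeg, Finset.mul_sum]
    rw [Finset.sum_comm]
    refine Finset.sum_eq_zero fun j hj => ?_
    have h := sum_intCast_mul_pow_eq_zero_of_coprime hN hz hsum (ha j (Finset.mem_range.1 hj))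
    rw [← mul_zero (Q.coeff j), ← h, Finset.mul_sum]
    refine Finset.sum_congr rfl fun i _ => ?_
    ring
  set S := (Finset.univ.image fun i => z i ^ l.factorial).erase (z t ^ l.factorial) with hS
  set Q : ℂ[X] := ∏ s ∈ S, (X - C s) with hQdef
  have hdeg : Q.natDegree < l := by
    rw [hQdef, natDegree_finsetProd_X_sub_C_eq_card]
    refine lt_of_lt_of_le (Finset.card_erase_lt_of_mem ?_) (Finset.card_image_le.trans hl)
    exact Finset.mem_image_of_mem _ (Finset.mem_univ t)
  have hQt : Q.eval (z t ^ l.factorial) ≠ 0 := by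
    rw [hQdef, eval_prod, Finset.prod_ne_zero_iff]
    intro s hs
    simpa [sub_eq_zero] using (Finset.ne_of_mem_erase hs).symm
  have hQi (i : ι) (hi : z i ≠ z t) : Q.eval (z i ^ l.factorial) = 0 := by
    rw [hQdef, eval_prod]
    refine Finset.prod_eq_zero (i := z i ^ l.factorial) ?_ (by simp)
    exact Finset.mem_erase.2 ⟨fun h => hi (hinj _ _ h),
      Finset.mem_image_of_mem _ (Finset.mem_univ i)⟩
  have hzt : z t ≠ 0 := fun h => by simpa [h, hN] using hz t
  have key := hQ Q hdeg
  rw [← Finset.sum_filter_of_ne (p := fun i => z i = z t)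
    fun i _ hne => not_not.1 fun hi => hne (by rw [hQi i hi, mul_zero])] at key
  rw [Finset.sum_congr rfl (g := fun i => (c i : ℂ) * (z t ^ a * Q.eval (z t ^ l.factorial)))
    fun i hi => by rw [(Finset.mem_filter.1 hi).2, mul_assoc], ← Finset.sum_mul] at key
  have := (mul_eq_zero.1 key).resolve_right (mul_ne_zero (pow_ne_zero _ hzt) hQt)
  exact_mod_cast this

theorem exists_pos_forall_pow_eq_one_imp_eq_one {D : ℕ} (hD : D ≠ 0) :
    ∃ η : ℝ, 0 < η ∧ ∀ w : ℂ, w ^ D = 1 → ‖w - 1‖ < η → w = 1 := by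
  have hc : Continuous fun w : ℂ => ∑ i ∈ Finset.range D, w ^ i := by fun_prop
  have h1 : (∑ i ∈ Finset.range D, (1 : ℂ) ^ i) ≠ 0 := by simpa using hD
  obtain ⟨η, hη, h⟩ := Metric.eventually_nhds_iff.1 (hc.continuousAt.eventually_ne h1)
  refine ⟨η, hη, fun w hw hw1 => ?_⟩
  have hne := h (dist_eq_norm w 1 ▸ hw1)
  have hmul := geom_sum_mul w D
  rw [hw, sub_self] at hmul
  exact sub_eq_zero.1 ((mul_eq_zero.1 hmul).resolve_left hne)

/-- Roots of unity that are close to a common point are determined by their `D`-th powers. -/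
theorem exists_pos_forall_eq_of_pow_eq {D : ℕ} (hD : D ≠ 0) :
    ∃ η : ℝ, 0 < η ∧ ∀ x y s : ℂ, ‖y‖ = 1 → x ^ D = y ^ D → ‖x - s‖ < η → ‖y - s‖ < η →
      x = y := by
  obtain ⟨η, hη, h⟩ := exists_pos_forall_pow_eq_one_imp_eq_one hD
  refine ⟨η / 2, half_pos hη, fun x y s hy hxy hx hys => ?_⟩
  have hy0 : y ≠ 0 := norm_ne_zero_iff.1 (by rw [hy]; exact one_ne_zero)
  refine (div_eq_one_iff_eq hy0).1 (h (x / y) ?_ ?_)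
  · rw [div_pow, hxy, div_self (pow_ne_zero _ hy0)]
  · rw [div_sub_one hy0, norm_div, hy, div_one, ← sub_sub_sub_cancel_right x y s]
    linarith [norm_sub_le (x - s) (y - s)]

/-- The point of the unit circle at angle `2πk/N`. -/
noncomputable def torusPoint (N k : ℕ) : ℂ :=
  Complex.exp ((2 * Real.pi * k / N : ℝ) * Complex.I)

theorem torusPoint_pow {N : ℕ} (hN : N ≠ 0) (k : ℕ) : torusPoint N k ^ N = 1 := by
  rw [torusPoint, ← Complex.exp_nat_mul, Complex.exp_eq_one_iff]
  refine ⟨k, ?_⟩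
  have : (N : ℂ) ≠ 0 := Nat.cast_ne_zero.2 hN
  push_cast
  field_simp

theorem torusPoint_injective {N : ℕ} (hN : N ≠ 0) :
    Function.Injective fun k : Fin N => torusPoint N k := by
  intro a b hab
  have hζ := Complex.isPrimitiveRoot_exp N hN
  have hpow (k : ℕ) : torusPoint N k = Complex.exp (2 * Real.pi * Complex.I / N) ^ k := by
    rw [torusPoint, ← Complex.exp_nat_mul]
    congr 1
    push_cast
    ring
  simp only [hpow] at hab
  exact Fin.ext (hζ.pow_inj a.2 b.2 hab)

theorem norm_torusPoint (N k : ℕ) : ‖torusPoint N k‖ = 1 :=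
  Complex.norm_exp_ofReal_mul_I _

theorem torusPoint_add_conj (N k : ℕ) :
    torusPoint N k + starRingEnd ℂ (torusPoint N k) =
      ((2 * Real.cos (2 * Real.pi * (k : ℝ) / N) : ℝ) : ℂ) := by
  rw [Complex.add_conj, torusPoint, Complex.exp_ofReal_mul_I_re]

theorem norm_torusPoint_sub_sq (N k : ℕ) {σ : ℝ} (hσ : σ ^ 2 = 1) :
    ‖torusPoint N k - σ‖ ^ 2 = 2 - σ * (2 * Real.cos (2 * Real.pi * (k : ℝ) / N)) := by
  rw [← Complex.normSq_eq_norm_sq, Complex.normSq_apply]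
  simp only [torusPoint, Complex.sub_re, Complex.sub_im, Complex.ofReal_re, Complex.ofReal_im,
    Complex.exp_ofReal_mul_I_re, Complex.exp_ofReal_mul_I_im]
  linear_combination hσ + Real.sin_sq_add_cos_sq (2 * Real.pi * (k : ℝ) / N)

/-- Two tuples with the same eigenvalue agree up to conjugation and permutation, provided that
`x ↦ x ^ (4d)!` is injective on the points involved. -/
theorem exists_torusPoint_eq_or_eq_conj {N d : ℕ} (hN : N ≠ 0) {k k' : Fin d → Fin N}
    (hsum : ∑ j, 2 * Real.cos (2 * Real.pi * (k j : ℝ) / N) =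
      ∑ j, 2 * Real.cos (2 * Real.pi * (k' j : ℝ) / N))
    {A : Set ℂ} (hA : ∀ x ∈ A, ∀ y ∈ A, x ^ (4 * d).factorial = y ^ (4 * d).factorial → x = y)
    (hk : ∀ j, torusPoint N (k j) ∈ A ∧ starRingEnd ℂ (torusPoint N (k j)) ∈ A)
    (hk' : ∀ j, torusPoint N (k' j) ∈ A ∧ starRingEnd ℂ (torusPoint N (k' j)) ∈ A)
    (i : Fin d) : ∃ j, torusPoint N (k' i) = torusPoint N (k j) ∨
      torusPoint N (k' i) = starRingEnd ℂ (torusPoint N (k j)) := by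
  by_contra! hne
  let c : (Fin d ⊕ Fin d) ⊕ (Fin d ⊕ Fin d) → ℤ := Sum.elim 1 (-1)
  let z : (Fin d ⊕ Fin d) ⊕ (Fin d ⊕ Fin d) → ℂ :=
    Sum.elim
      (Sum.elim (fun j => torusPoint N (k j)) (fun j => starRingEnd ℂ (torusPoint N (k j))))
      (Sum.elim (fun j => torusPoint N (k' j)) (fun j => starRingEnd ℂ (torusPoint N (k' j))))
  have hzA : ∀ x, z x ∈ A := by
    rintro ((j | j) | (j | j))
    exacts [(hk j).1, (hk j).2, (hk' j).1, (hk' j).2]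
  have hz : ∀ x, z x ^ N = 1 := by
    rintro ((j | j) | (j | j)) <;> simp [z, ← map_pow, torusPoint_pow hN]
  have hrel : ∑ x, (c x : ℂ) * z x = 0 := by
    have h := congrArg (fun x : ℝ => (x : ℂ)) hsum
    simp only [Complex.ofReal_sum, ← torusPoint_add_conj, Finset.sum_add_distrib] at h
    simp only [Fintype.sum_sum_type, c, z, Sum.elim_inl, Sum.elim_inr, Pi.one_apply,
      Pi.neg_apply, Int.cast_neg, Int.cast_one, neg_mul, one_mul, Finset.sum_neg_distrib]
    linear_combination h
  have hcard : Fintype.card ((Fin d ⊕ Fin d) ⊕ (Fin d ⊕ Fin d)) ≤ 4 * d := by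
    simp only [Fintype.card_sum, Fintype.card_fin]
    omega
  have h0 := sum_filter_eq_zero_of_injOn_pow_factorial hN hcard hz
    (fun x y => hA _ (hzA x) _ (hzA y)) hrel (torusPoint N (k' i))
  refine absurd h0 (ne_of_lt (Finset.sum_neg ?_ ⟨Sum.inr (Sum.inl i), by simp [z]⟩))
  rintro ((j | j) | (j | j)) hj
  · exact absurd (Finset.mem_filter.1 hj).2.symm (hne j).1
  · exact absurd (Finset.mem_filter.1 hj).2.symm (hne j).2
  · simp [c]
  · simp [c]

/-- If all solutions involve only points on which `x ↦ x ^ (4d)!` is injective, the multiplicity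
is at most `(2d)^d`. -/
theorem torusMult_le_of_injOn {N d : ℕ} (hN : N ≠ 0) {μ : ℝ} {A : Set ℂ}
    (hA : ∀ x ∈ A, ∀ y ∈ A, x ^ (4 * d).factorial = y ^ (4 * d).factorial → x = y)
    (hμ : ∀ k : Fin d → Fin N, ∑ j, 2 * Real.cos (2 * Real.pi * (k j : ℝ) / N) = μ →
      ∀ j, torusPoint N (k j) ∈ A ∧ starRingEnd ℂ (torusPoint N (k j)) ∈ A) :
    torusMult N d μ ≤ (2 * d) ^ d := by
  classical
  rw [torusMult, Nat.card_eq_fintype_card, Fintype.card_subtype]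
  set M := Finset.univ.filter fun k : Fin d → Fin N =>
    ∑ j, 2 * Real.cos (2 * Real.pi * (k j : ℝ) / N) = μ with hM
  rcases M.eq_empty_or_nonempty with h | ⟨k, hk⟩
  · simp [h]
  have hk := (Finset.mem_filter.1 hk).2
  let B : Finset (Fin N) := Finset.univ.filter fun x => ∃ j, torusPoint N x = torusPoint N (k j) ∨
    torusPoint N x = starRingEnd ℂ (torusPoint N (k j))
  have hB : B.card ≤ 2 * d := by
    let T : Finset ℂ := Finset.univ.image (Sum.elim (fun j => torusPoint N (k j))
      (fun j => starRingEnd ℂ (torusPoint N (k j))))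
    have hT : T.card ≤ 2 * d := Finset.card_image_le.trans (by simp [two_mul])
    refine le_trans (Finset.card_le_card_of_injOn (fun x : Fin N => torusPoint N x) ?_
      (torusPoint_injective hN).injOn) hT
    intro x hx
    obtain ⟨j, hj | hj⟩ := (Finset.mem_filter.1 hx).2
    · exact Finset.mem_image.2 ⟨Sum.inl j, Finset.mem_univ _, hj.symm⟩
    · exact Finset.mem_image.2 ⟨Sum.inr j, Finset.mem_univ _, hj.symm⟩
  have hsub : M ⊆ Fintype.piFinset fun _ => B := by
    intro k' hk'
    have hk' := (Finset.mem_filter.1 hk').2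
    rw [Fintype.mem_piFinset]
    exact fun i => Finset.mem_filter.2 ⟨Finset.mem_univ _,
      exists_torusPoint_eq_or_eq_conj hN (hk.trans hk'.symm) hA (hμ k hk) (hμ k' hk') i⟩
  calc M.card ≤ (Fintype.piFinset fun _ : Fin d => B).card := Finset.card_le_card hsub
    _ = B.card ^ d := by simp
    _ ≤ (2 * d) ^ d := Nat.pow_le_pow_left hB d

theorem pow_le_natCard_of_forall_injective {N d m : ℕ} {f : Fin m → Fin N}
    (hf : Function.Injective f) {p : (Fin d → Fin N) → Prop} (hp : ∀ g : Fin d → Fin m, p (f ∘ g)) :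
    m ^ d ≤ Nat.card {k // p k} := by
  have h := Nat.card_le_card_of_injective
    (fun g : Fin d → Fin m => (⟨f ∘ g, hp g⟩ : {k // p k}))
    fun g g' h => hf.comp_left (Subtype.ext_iff.1 h)
  simpa using h

/-- Near each of the two ends `σ = ±1` of the range of the cosine there are `⌊δN⌋` points. -/
theorem exists_injective_cos_close {N m : ℕ} (hN : N ≠ 0) {δ : ℝ} (hδ : δ < 1 / 2)
    (hm : (m : ℝ) ≤ δ * N) {σ : ℝ} (hσ : σ = 1 ∨ σ = -1) :
    ∃ f : Fin m → Fin N, Function.Injective f ∧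
      ∀ i, 2 - σ * (2 * Real.cos (2 * Real.pi * (f i : ℝ) / N)) ≤ (2 * Real.pi * δ) ^ 2 := by
  have hN0 : (0 : ℝ) < N := Nat.cast_pos.2 (Nat.pos_of_ne_zero hN)
  have hmN : 2 * m < N := by
    have : (2 * m : ℝ) < N := by nlinarith
    exact_mod_cast this
  have hsq (y t : ℝ) (ht : σ * Real.cos y = Real.cos (2 * Real.pi * t / N)) (h0 : 0 ≤ t)
      (h1 : t ≤ m) :
      2 - σ * (2 * Real.cos y) ≤ (2 * Real.pi * δ) ^ 2 := by
    have hb := Real.one_sub_sq_div_two_le_cos (x := 2 * Real.pi * t / N)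
    have h2 : 2 * Real.pi * t / N ≤ 2 * Real.pi * δ := by
      rw [div_le_iff₀ hN0, mul_assoc (2 * Real.pi) δ]
      exact mul_le_mul_of_nonneg_left (h1.trans hm) (by positivity)
    have h3 := pow_le_pow_left₀ (by positivity) h2 2
    linarith
  rcases hσ with rfl | rfl
  · refine ⟨fun i => ⟨i, by omega⟩, fun i j h => Fin.ext (by simpa using h), fun i => ?_⟩
    exact hsq _ i (one_mul _) (by positivity) (by exact_mod_cast i.2.le)
  · refine ⟨fun i => ⟨(N + 1) / 2 + i, by omega⟩, fun i j h => Fin.ext (by simpa using h),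
      fun i => ?_⟩
    have hlo : (N : ℝ) ≤ 2 * ((N + 1) / 2 + i : ℕ) := by
      exact_mod_cast (by omega : N ≤ 2 * ((N + 1) / 2 + i))
    have hhi : 2 * (((N + 1) / 2 + i : ℕ) : ℝ) ≤ N + 2 * m := by
      exact_mod_cast (by omega : 2 * ((N + 1) / 2 + i) ≤ N + 2 * m)
    refine hsq _ ((((N + 1) / 2 + i : ℕ) : ℝ) - N / 2) ?_ (by linarith) (by linarith)
    rw [neg_one_mul, ← Real.cos_sub_pi]
    congr 1
    field_simp

/-- An eigenvalue away from the end `σ = ±1` of the spectrum has many eigenvalues beyond it. -/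
theorem mul_pow_le_natCard {N d : ℕ} (hN : N ≠ 0) {δ ε : ℝ} (hδ0 : 0 < δ)
    (hδ : δ < 1 / 2) (hδN : 1 ≤ δ * N) (hε : d * (2 * Real.pi * δ) ^ 2 < ε) {σ μ : ℝ}
    (hσ : σ = 1 ∨ σ = -1) (hμ : ε ≤ 2 * d - σ * μ) :
    (δ / 2) ^ d * (N : ℝ) ^ d ≤ Nat.card {k : Fin d → Fin N //
      σ * μ < σ * ∑ j, 2 * Real.cos (2 * Real.pi * (k j : ℝ) / N)} := by
  set m := ⌊δ * N⌋₊
  have hm : (m : ℝ) ≤ δ * N := Nat.floor_le (by positivity)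
  have hm1 : (1 : ℝ) ≤ m := by exact_mod_cast (Nat.one_le_floor_iff _).2 hδN
  have hm2 : δ * N < m + 1 := Nat.lt_floor_add_one _
  obtain ⟨f, hf, hcos⟩ := exists_injective_cos_close hN hδ hm hσ
  have hcard := pow_le_natCard_of_forall_injective (d := d) hf
    (p := fun k => σ * μ < σ * ∑ j, 2 * Real.cos (2 * Real.pi * (k j : ℝ) / N)) fun g => by
      have h := Finset.sum_le_sum fun (j : Fin d) (_ : j ∈ Finset.univ) => hcos (g j)
      rw [Finset.sum_sub_distrib, ← Finset.mul_sum] at h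
      simp only [Finset.sum_const, Finset.card_univ, Fintype.card_fin, nsmul_eq_mul] at h
      simp only [Function.comp_apply]
      linarith
  calc (δ / 2) ^ d * (N : ℝ) ^ d = (δ / 2 * N) ^ d := (mul_pow _ _ _).symm
    _ ≤ (m : ℝ) ^ d := pow_le_pow_left₀ (by positivity) (by linarith) d
    _ ≤ _ := by exact_mod_cast hcard

theorem torusMult_le_pow (N d : ℕ) (μ : ℝ) : torusMult N d μ ≤ N ^ d := by
  have h := Nat.card_le_card_of_injective _ (Subtype.val_injective (p := fun k : Fin d → Fin N =>
    (∑ j, 2 * Real.cos (2 * Real.pi * (k j : ℝ) / N)) = μ))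
  simpa [torusMult] using h

/-- Eigenvalues close to an end `σ = ±1` of the spectrum have bounded multiplicity. -/
theorem torusMult_le_of_close {N d : ℕ} (hN : N ≠ 0) {η : ℝ} (hη0 : 0 < η)
    (hη : ∀ x y s : ℂ, ‖y‖ = 1 → x ^ (4 * d).factorial = y ^ (4 * d).factorial → ‖x - s‖ < η →
      ‖y - s‖ < η → x = y)
    {σ μ : ℝ} (hσ : σ = 1 ∨ σ = -1) (hμ : 2 * d - σ * μ < η ^ 2) :
    torusMult N d μ ≤ (2 * d) ^ d := by
  have hσ2 : σ ^ 2 = 1 := by rcases hσ with rfl | rfl <;> norm_num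
  refine torusMult_le_of_injOn hN (A := {x | ‖x‖ = 1 ∧ ‖x - σ‖ < η})
    (fun x hx y hy h => hη x y σ hy.1 h hx.2 hy.2) fun k hk j => ?_
  have hj : ‖torusPoint N (k j) - σ‖ < η := by
    refine lt_of_pow_lt_pow_left₀ 2 hη0.le (lt_of_le_of_lt ?_ hμ)
    refine (Finset.single_le_sum (f := fun j => ‖torusPoint N (k j) - σ‖ ^ 2)
      (fun j _ => sq_nonneg _) (Finset.mem_univ j)).trans_eq ?_
    simp only [norm_torusPoint_sub_sq N _ hσ2]
    rw [Finset.sum_sub_distrib, ← Finset.mul_sum, hk]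
    simp [mul_comm]
  refine ⟨⟨norm_torusPoint _ _, hj⟩, by rw [Complex.norm_conj, norm_torusPoint], ?_⟩
  rwa [← Complex.conj_ofReal, ← map_sub, Complex.norm_conj]

theorem mult_bounded_in_long_range (d : ℕ) (hd : 1 ≤ d) :
    ∃ c C : ℝ, 0 < c ∧ c ≤ 1 / 2 ∧ 0 < C ∧
      ∀ N : ℕ, 3 ≤ N → ∀ μ : ℝ, 1 ≤ torusMult N d μ →
        ((torusCountGT N d μ : ℝ) < c * (N : ℝ) ^ d ∨
         (torusCountLT N d μ : ℝ) < c * (N : ℝ) ^ d) →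
        (torusMult N d μ : ℝ) ≤ C := by
  obtain ⟨η, hη0, hη⟩ := exists_pos_forall_eq_of_pow_eq (Nat.factorial_ne_zero (4 * d))
  obtain ⟨δ, hδ0, hδ, hδη⟩ : ∃ δ : ℝ, 0 < δ ∧ δ < 1 / 2 ∧ d * (2 * Real.pi * δ) ^ 2 < η ^ 2 := by
    have hc : Continuous fun δ : ℝ => d * (2 * Real.pi * δ) ^ 2 := by fun_prop
    have h1 := (hc.tendsto 0).eventually_lt_const
      (show d * (2 * Real.pi * 0) ^ 2 < η ^ 2 by simpa using pow_pos hη0 2)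
    have h2 := eventually_lt_nhds (by norm_num : (0 : ℝ) < 1 / 2)
    obtain ⟨δ, ⟨h1, h2⟩, h3⟩ := (((h1.and h2).filter_mono nhdsWithin_le_nhds).and
      (self_mem_nhdsWithin (s := Set.Ioi (0 : ℝ)))).exists
    exact ⟨δ, h3, h2, h1⟩
  refine ⟨(δ / 2) ^ d, (2 * d) ^ d + (1 / δ) ^ d, by positivity, ?_, by positivity, ?_⟩
  · exact (pow_le_of_le_one (by positivity) (by linarith) (by omega)).trans (by linarith)
  intro N hN μ _ hcount
  have hN0 : N ≠ 0 := by omega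
  rcases lt_or_ge (δ * N) 1 with hsmall | hδN
  · have h1 : (torusMult N d μ : ℝ) ≤ (N : ℝ) ^ d := by exact_mod_cast torusMult_le_pow N d μ
    have h2 : (N : ℝ) ≤ 1 / δ := by
      rw [le_div_iff₀ hδ0]
      linarith
    have h3 := pow_le_pow_left₀ (Nat.cast_nonneg N) h2 d
    have h4 : (0 : ℝ) ≤ (2 * d) ^ d := by positivity
    linarith
  obtain ⟨σ, hσ, hμ⟩ : ∃ σ : ℝ, (σ = 1 ∨ σ = -1) ∧ 2 * d - σ * μ < η ^ 2 := by
    by_contra! h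
    have hgt := mul_pow_le_natCard hN0 hδ0 hδ hδN hδη (.inl rfl) (h 1 (.inl rfl))
    have hlt := mul_pow_le_natCard hN0 hδ0 hδ hδN hδη (.inr rfl) (h (-1) (.inr rfl))
    simp only [one_mul] at hgt
    simp only [neg_one_mul, neg_lt_neg_iff] at hlt
    rcases hcount with hcount | hcount
    · exact absurd hgt (not_le.2 hcount)
    · exact absurd hlt (not_le.2 hcount)
  have h1 : (torusMult N d μ : ℝ) ≤ (2 * d) ^ d := by
    exact_mod_cast torusMult_le_of_close hN0 hη0 hη hσ hμ
  have h2 : (0 : ℝ) ≤ (1 / δ) ^ d := by positivity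
  linarith
end

section
/- For every integer d ≥ 1 there exists a constant C > 0, depending only on d, such that for every integer N ≥ 2 with smallest prime factor p_1 and every eigenvalue μ of the discrete torus T^d_N, the multiplicity satisfies m_{T^d_N}(μ) ≤ C·N^{d/p_1}. In particular, m_{T^d_N}(μ) ≤ C·N^{d/2}. -/
open Finset

/-- An integral relation between powers of a primitive root of unity is preserved by conjugation. -/
theorem IsPrimitiveRoot.sum_conj_eq_zero {ι : Type*} {ω : ℂ} {M : ℕ} (hω : IsPrimitiveRoot ω M)
    (hM : 0 < M) (s : Finset ι) (a : ι → ℤ) (e : ι → ℕ)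
    (h : ∑ i ∈ s, (a i : ℂ) * ω ^ e i = 0) {t : ℕ} (ht : t.Coprime M) :
    ∑ i ∈ s, (a i : ℂ) * (ω ^ t) ^ e i = 0 := by
  have aeval_eq (x : ℂ) :
      Polynomial.aeval x (∑ i ∈ s, Polynomial.C (a i) * Polynomial.X ^ e i) =
        ∑ i ∈ s, (a i : ℂ) * x ^ e i := by
    simp
  have hdvd := minpoly.isIntegrallyClosed_dvd (hω.isIntegral hM) ((aeval_eq ω).trans h)
  rw [hω.minpoly_eq_pow_coprime ht] at hdvd
  rw [← aeval_eq]
  exact Polynomial.aeval_eq_zero_of_dvd_aeval_eq_zero hdvd (minpoly.aeval _ _)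

/-- If `p ^ 2 ∣ M`, or if there are fewer than `p` terms, then a vanishing integral combination of
`M`-th roots of unity splits into vanishing parts according to the exponents modulo `p`. -/
theorem IsPrimitiveRoot.sum_filter_mod_eq_zero {ι : Type*} {ω : ℂ} {M p : ℕ}
    (hω : IsPrimitiveRoot ω M) (hM : 0 < M) (hp : p.Prime) (hpM : p ∣ M) (s : Finset ι)
    (hs : p * p ∣ M ∨ #s < p) (a : ι → ℤ) (e : ι → ℕ)
    (h : ∑ i ∈ s, (a i : ℂ) * ω ^ e i = 0) (r : ℕ) :
    ∑ i ∈ s with e i ≡ r [MOD p], (a i : ℂ) * ω ^ e i = 0 := by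
  obtain ⟨M', rfl⟩ := hpM
  have hξ : IsPrimitiveRoot (ω ^ M') p := hω.pow hM (mul_comm _ _)
  set ξ := ω ^ M' with hξdef
  let A : ℕ → ℂ := fun u ↦ ∑ i ∈ s, (a i : ℂ) * ω ^ e i * ξ ^ (u * e i)
  have key (r : ℕ) : ∑ u ∈ range p, ξ ^ (u * ((p - 1) * r)) * A u =
      p * ∑ i ∈ s with e i ≡ r [MOD p], (a i : ℂ) * ω ^ e i := by
    simp only [A, mul_sum]
    rw [sum_comm, sum_filter]
    refine sum_congr rfl fun i _ ↦ ?_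
    have hmod : p ∣ (p - 1) * r + e i ↔ e i ≡ r [MOD p] := by
      have h1 : (p - 1) * r + r = p * r := by
        rw [← Nat.succ_mul, Nat.succ_eq_add_one, Nat.sub_add_cancel hp.one_le]
      have h2 : (p - 1) * r + r ≡ 0 [MOD p] := by
        rw [h1]; exact Nat.modEq_zero_iff_dvd.2 (dvd_mul_right _ _)
      rw [← Nat.modEq_zero_iff_dvd]
      exact ⟨fun h3 ↦ Nat.ModEq.add_left_cancel' _ (h3.trans h2.symm),
        fun h3 ↦ (Nat.ModEq.add_left _ h3).trans h2⟩
    have hterm : ∀ u ∈ range p, ξ ^ (u * ((p - 1) * r)) * (a i * ω ^ e i * ξ ^ (u * e i)) =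
        a i * ω ^ e i * (ξ ^ ((p - 1) * r + e i)) ^ u := by
      intro u _
      rw [mul_left_comm, ← pow_add, ← pow_mul ξ, add_mul, add_comm, mul_comm u, mul_comm u,
        add_comm]
    rw [sum_congr rfl hterm, ← mul_sum]
    split_ifs with hr
    · rw [(hξ.pow_eq_one_iff_dvd _).2 (hmod.2 hr)]
      simp [mul_comm]
    · have hne : ξ ^ ((p - 1) * r + e i) ≠ 1 := fun h1 ↦
        hr (hmod.1 ((hξ.pow_eq_one_iff_dvd _).1 h1))
      rw [geom_sum_eq hne, ← pow_mul, mul_comm _ p, pow_mul, hξ.pow_eq_one]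
      simp
  have hgood (u : ℕ) (hu : ¬ p ∣ 1 + u * M') : A u = 0 := by
    have hcop : (1 + u * M').Coprime (p * M') := by
      refine Nat.Coprime.mul_right ((Nat.Prime.coprime_iff_not_dvd hp).2 hu).symm ?_
      simp
    rw [← hω.sum_conj_eq_zero hM s a e h hcop]
    refine sum_congr rfl fun i _ ↦ ?_
    rw [hξdef, mul_assoc, ← pow_mul, ← pow_mul, ← pow_add]
    ring_nf
  have hA (u : ℕ) (hu : u < p) : A u = 0 := by
    by_cases hbad : p ∣ 1 + u * M'
    · have hpM' : ¬ p ∣ M' := fun h1 ↦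
        hp.one_lt.ne' (Nat.dvd_one.1 ((Nat.dvd_add_left (h1.mul_left u)).1 hbad))
      have hcard : #s < p := hs.resolve_left fun h1 ↦
        hpM' (Nat.dvd_of_mul_dvd_mul_left hp.pos h1)
      obtain ⟨r, hr, hrs⟩ : ∃ r ∈ range p, r ∉ s.image (e · % p) := by
        by_contra! hcon
        have := (card_le_card hcon).trans card_image_le
        simp only [card_range] at this
        omega
      have hempty : ∑ i ∈ s with e i ≡ r [MOD p], (a i : ℂ) * ω ^ e i = 0 := by
        rw [filter_false_of_mem, sum_empty]
        intro i hi hir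
        refine hrs (mem_image.2 ⟨i, hi, ?_⟩)
        exact Eq.trans hir (Nat.mod_eq_of_lt (mem_range.1 hr))
      have hsum := key r
      rw [hempty, mul_zero, sum_eq_single u] at hsum
      · exact (mul_eq_zero.1 hsum).resolve_left
          (pow_ne_zero _ (hξ.ne_zero hp.ne_zero))
      · intro v hv hvu
        rw [hgood v, mul_zero]
        intro hv'
        have hmod : 1 + v * M' ≡ 1 + u * M' [MOD p] :=
          (Nat.modEq_zero_iff_dvd.2 hv').trans (Nat.modEq_zero_iff_dvd.2 hbad).symm
        have h1 : v ≡ u [MOD p] :=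
          Nat.ModEq.cancel_right_of_coprime ((Nat.Prime.coprime_iff_not_dvd hp).2 hpM')
            (Nat.ModEq.add_left_cancel' _ hmod)
        exact hvu (Nat.ModEq.eq_of_lt_of_lt h1 (mem_range.1 hv) hu)
      · exact fun h1 ↦ absurd (mem_range.2 hu) h1
    · exact hgood u hbad
  have hsum := key r
  rw [sum_eq_zero fun u hu ↦ by rw [hA u (mem_range.1 hu), mul_zero]] at hsum
  exact (mul_eq_zero.1 hsum.symm).resolve_left (Nat.cast_ne_zero.2 hp.ne_zero)

/-- `s` indexes a vanishing sum of `f` having no nonempty proper vanishing subsum. -/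
def IsMinimalVanishing {ι : Type*} (f : ι → ℂ) (s : Finset ι) : Prop :=
  ∑ i ∈ s, f i = 0 ∧ ∀ t ⊆ s, t.Nonempty → ∑ i ∈ t, f i = 0 → t = s

theorem exists_isMinimalVanishing {ι : Type*} [DecidableEq ι] (f : ι → ℂ) (T : Finset ι)
    (hT : ∑ i ∈ T, f i = 0) {x : ι} (hx : x ∈ T) :
    ∃ B, x ∈ B ∧ IsMinimalVanishing f B := by
  induction T using Finset.strongInduction with
  | H T ih =>
    by_cases hmin : ∀ t ⊆ T, t.Nonempty → ∑ i ∈ t, f i = 0 → t = T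
    · exact ⟨T, hx, hT, hmin⟩
    · push Not at hmin
      obtain ⟨t, htT, hne, ht, htne⟩ := hmin
      by_cases hxt : x ∈ t
      · exact ih t (htT.ssubset_of_ne htne) ht hxt
      · refine ih (T \ t) (sdiff_ssubset htT hne) ?_ (mem_sdiff.2 ⟨hx, hxt⟩)
        rw [← sum_sdiff htT, ht, add_zero] at hT
        exact hT

/-- The **theorem of Mann**: in a minimal vanishing integral combination of `n` roots of unity, the
order of every ratio divides the product of the primes up to `n`. -/
theorem IsMinimalVanishing.pow_primorial_eq {ι : Type*} {a : ι → ℤ} {z : ι → ℂ} {s : Finset ι}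
    (hmin : IsMinimalVanishing (fun i ↦ (a i : ℂ) * z i) s) {N : ℕ} (hN : 0 < N)
    (hz : ∀ i ∈ s, z i ^ N = 1) {i j : ι} (hi : i ∈ s) (hj : j ∈ s) :
    z i ^ primorial #s = z j ^ primorial #s := by
  suffices H : ∀ M, 0 < M → (∀ i ∈ s, ∀ j ∈ s, z i ^ M = z j ^ M) →
      ∀ i ∈ s, ∀ j ∈ s, z i ^ primorial #s = z j ^ primorial #s from
    H N hN (fun i hi j hj ↦ (hz i hi).trans (hz j hj).symm) i hi j hj
  intro M
  induction M using Nat.strong_induction_on with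
  | _ M ih =>
  intro hM hzM
  by_cases hp : ∃ p, p.Prime ∧ p ∣ M ∧ (p * p ∣ M ∨ #s < p)
  · obtain ⟨p, hp, hpM, hps⟩ := hp
    refine ih (M / p) (Nat.div_lt_self hM hp.one_lt)
      (Nat.div_pos (Nat.le_of_dvd hM hpM) hp.pos) fun i hi j hj ↦ ?_
    have hω := Complex.isPrimitiveRoot_exp M hM.ne'
    set ω := Complex.exp (2 * Real.pi * Complex.I / M)
    have hz0 : ∀ i ∈ s, z i ≠ 0 := fun i hi h0 ↦ by
      simpa [h0, hN.ne'] using hz i hi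
    have hex : ∀ i, ∃ e : ℕ, i ∈ s → ω ^ e = z i / z j := by
      intro i
      by_cases hi : i ∈ s
      · have : NeZero M := ⟨hM.ne'⟩
        obtain ⟨e, -, he⟩ := hω.eq_pow_of_pow_eq_one (ξ := z i / z j) (by
          rw [div_pow, hzM i hi j hj, div_self (pow_ne_zero _ (hz0 j hj))])
        exact ⟨e, fun _ ↦ he⟩
      · exact ⟨0, fun h ↦ absurd h hi⟩
    choose e he using hex
    have hsub : ∀ t ⊆ s, ∑ i ∈ t, (a i : ℂ) * ω ^ e i = (∑ i ∈ t, (a i : ℂ) * z i) / z j := by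
      intro t ht
      rw [sum_div]
      exact sum_congr rfl fun i hi ↦ by rw [he i (ht hi), mul_div_assoc]
    have hsplit := hω.sum_filter_mod_eq_zero hM hp hpM s hps a e
      (by rw [hsub s subset_rfl, hmin.1, zero_div]) (e j)
    rw [hsub _ (filter_subset _ _), div_eq_zero_iff, or_iff_left (hz0 j hj)] at hsplit
    have hall := hmin.2 _ (filter_subset _ _) ⟨j, mem_filter.2 ⟨hj, Nat.ModEq.refl (e j)⟩⟩ hsplit
    have hij : e i ≡ e j [MOD p] := by
      rw [← hall] at hi
      exact (mem_filter.1 hi).2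
    have hpow : (ω ^ e i) ^ (M / p) = (ω ^ e j) ^ (M / p) := by
      rw [← pow_mul, ← pow_mul]
      have := hij.mul_right' (M / p)
      rw [Nat.mul_div_cancel' hpM] at this
      rw [← pow_mod_orderOf, ← hω.eq_orderOf, this, hω.eq_orderOf, pow_mod_orderOf]
    rw [he i hi, he j hj, div_self (hz0 j hj), one_pow, div_pow,
      div_eq_one_iff_eq (pow_ne_zero _ (hz0 j hj))] at hpow
    exact hpow
  · push Not at hp
    have hsq : Squarefree M := by
      rw [Nat.squarefree_iff_prime_squarefree]
      exact fun p hpp h ↦ (hp p hpp ((dvd_mul_right p p).trans h)).1 h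
    have hdvd : M ∣ primorial #s := by
      rw [← Nat.prod_primeFactors_of_squarefree hsq]
      refine prod_dvd_prod_of_subset _ _ _ fun p hpM ↦ ?_
      have hpp := Nat.prime_of_mem_primeFactors hpM
      have := (hp p hpp (Nat.dvd_of_mem_primeFactors hpM)).2
      simp only [mem_filter, mem_range]
      exact ⟨by omega, hpp⟩
    obtain ⟨q, hq⟩ := hdvd
    intro i hi j hj
    rw [hq, pow_mul, pow_mul, hzM i hi j hj]

/-- A minimal vanishing sum of `N`-th roots of unity has at least `N.minFac` terms. -/
theorem IsMinimalVanishing.minFac_le_card {ι : Type*} {z : ι → ℂ} {s : Finset ι}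
    (hmin : IsMinimalVanishing z s) (hs : s.Nonempty) {N : ℕ} (hN : 0 < N)
    (hz : ∀ i ∈ s, z i ^ N = 1) : N.minFac ≤ #s := by
  by_contra! hlt
  obtain ⟨j, hj⟩ := hs
  have hz0 : z j ≠ 0 := fun h0 ↦ by simpa [h0, hN.ne'] using hz j hj
  have hcop : (primorial #s).Coprime N := by
    refine Nat.Coprime.prod_left fun p hp ↦ ?_
    simp only [mem_filter, mem_range] at hp
    rw [Nat.Prime.coprime_iff_not_dvd hp.2]
    intro hpN
    have := Nat.minFac_le_of_dvd hp.2.two_le hpN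
    omega
  have hmin' : IsMinimalVanishing (fun i ↦ ((1 : ℤ) : ℂ) * z i) s := by simpa using hmin
  have heq : ∀ i ∈ s, z i = z j := by
    intro i hi
    have h1 : (z i / z j) ^ primorial #s = 1 := by
      rw [div_pow, hmin'.pow_primorial_eq hN hz hi hj, div_self (pow_ne_zero _ hz0)]
    have h2 : (z i / z j) ^ N = 1 := by rw [div_pow, hz i hi, hz j hj, div_one]
    have h3 := pow_gcd_eq_one.2 ⟨h1, h2⟩
    rw [hcop, pow_one] at h3
    exact (div_eq_one_iff_eq hz0).1 h3
  have hsum := hmin.1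
  rw [sum_congr rfl heq, sum_const, nsmul_eq_mul, mul_eq_zero, or_iff_left hz0,
    Nat.cast_eq_zero, card_eq_zero] at hsum
  simp [hsum] at hj

/-- If `∑ (w j + (w j)⁻¹) = ∑ (w₀ j + (w₀ j)⁻¹)` for `N`-th roots of unity, then, up to inversion
and roots of unity of bounded order, each `w i` is `1`, or one of the `w₀ j`, or agrees with at
least `N.minFac` of the `w j`. -/
theorem minFac_le_card_filter_of_sum_eq {d N : ℕ} (hN : 0 < N) {w w₀ : Fin d → ℂ}
    (hw : ∀ j, w j ^ N = 1) (hw₀ : ∀ j, w₀ j ^ N = 1)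
    (hsum : ∑ j, (w j + (w j)⁻¹) = ∑ j, (w₀ j + (w₀ j)⁻¹)) {P : ℕ}
    (hP : P = primorial (4 * d)) {κ : ℂ → ℂ} (hκ : ∀ x, κ x = x ^ P + (x ^ P)⁻¹) (i : Fin d)
    (h2 : κ (w i) ≠ 2) (h2' : κ (w i) ≠ -2) (h₀ : ∀ j, κ (w i) ≠ κ (w₀ j)) :
    N.minFac ≤ #{j | κ (w j) = κ (w i)} := by
  let v : (Fin d × Bool) ⊕ (Fin d × Bool) → ℂ :=
    Sum.elim (fun x ↦ if x.2 then w x.1 else (w x.1)⁻¹)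
      (fun x ↦ if x.2 then w₀ x.1 else (w₀ x.1)⁻¹)
  let a : (Fin d × Bool) ⊕ (Fin d × Bool) → ℤ := Sum.elim (fun _ ↦ 1) (fun _ ↦ -1)
  have hv : ∀ x, v x ^ N = 1 := by
    rintro (⟨j, b⟩ | ⟨j, b⟩) <;> cases b <;> simp [v, hw, hw₀]
  have htotal : ∑ x, (a x : ℂ) * v x = 0 := by
    simp only [Fintype.sum_sum_type, Fintype.sum_prod_type, Fintype.sum_bool, a, v]
    simp only [Sum.elim_inl, Sum.elim_inr, if_true, Bool.false_eq_true, if_false, Int.cast_one,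
      Int.cast_neg, one_mul, neg_mul, ← neg_add, sum_neg_distrib, hsum, add_neg_cancel]
  obtain ⟨B, hiB, hB⟩ := exists_isMinimalVanishing _ univ htotal (mem_univ (.inl (i, true)))
  have hcard : #B ≤ 4 * d := by
    refine (card_le_univ B).trans ?_
    simp only [Fintype.card_sum, Fintype.card_prod, Fintype.card_fin, Fintype.card_bool]
    omega
  have hpow : ∀ x ∈ B, v x ^ P = w i ^ P := by
    intro x hx
    obtain ⟨q, hq⟩ := primorial_dvd_primorial hcard
    have := hB.pow_primorial_eq hN (fun x _ ↦ hv x) hx hiB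
    rw [hP, hq, pow_mul, this, ← pow_mul]
    simp [v]
  have hinl : ∀ x ∈ B, ∃ y, x = .inl y := by
    rintro (y | ⟨j, b⟩) hx
    · exact ⟨y, rfl⟩
    · refine absurd ?_ (h₀ j)
      rw [hκ, hκ, ← hpow _ hx]
      cases b <;> simp [v, add_comm]
  have hB' : IsMinimalVanishing v B := by
    have hav : ∀ t ⊆ B, ∑ x ∈ t, (a x : ℂ) * v x = ∑ x ∈ t, v x := fun t ht ↦
      sum_congr rfl fun x hx ↦ by
        obtain ⟨y, rfl⟩ := hinl x (ht hx)
        simp [a]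
    exact ⟨(hav B subset_rfl).symm.trans hB.1,
      fun t ht hne h0 ↦ hB.2 t ht hne ((hav t ht).trans h0)⟩
  refine (hB'.minFac_le_card ⟨_, hiB⟩ hN fun x _ ↦ hv x).trans ?_
  have hnot : ∀ j, .inl (j, true) ∈ B → .inl (j, false) ∈ B → False := by
    intro j ht hf
    have e1 : w j ^ P = w i ^ P := by simpa [v] using hpow _ ht
    have e2 : (w i ^ P)⁻¹ = w i ^ P := by simpa [v, e1] using hpow _ hf
    have hne : w i ^ P ≠ 0 := pow_ne_zero _ fun h0 ↦ by simpa [h0, hN.ne'] using hw i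
    have e3 : w i ^ P * w i ^ P = 1 := by
      nth_rewrite 1 [← e2]
      exact inv_mul_cancel₀ hne
    rcases mul_self_eq_one_iff.1 e3 with h | h
    · exact h2 (by rw [hκ, h]; norm_num)
    · exact h2' (by rw [hκ, h]; norm_num)
  refine card_le_card_of_injOn (Sum.elim Prod.fst Prod.fst) ?_ ?_
  · intro x hx
    obtain ⟨⟨j, b⟩, rfl⟩ := hinl x hx
    simp only [Sum.elim_inl, coe_filter, mem_univ, true_and, Set.mem_ofPred_eq]
    rw [hκ, hκ, ← hpow _ hx]
    cases b <;> simp [v, add_comm]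
  · intro x hx y hy hxy
    obtain ⟨⟨j, b⟩, rfl⟩ := hinl x hx
    obtain ⟨⟨j', b'⟩, rfl⟩ := hinl y hy
    obtain rfl : j = j' := hxy
    cases b <;> cases b'
    · rfl
    · exact (hnot j hy hx).elim
    · exact (hnot j hx hy).elim
    · rfl

/-- Counting functions `k` into `G` such that, up to finitely many exceptional values, each value
taken by `c ∘ k` is taken at least `p` times. -/
theorem card_le_of_large_fibers {G K : Type*} [Fintype G] [Nonempty G] [DecidableEq G]
    [DecidableEq K] {d p q : ℕ} (hp : 0 < p) (c : G → K) (hq : ∀ t, #{x | c x = t} ≤ q)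
    (F : Finset K) (S : Finset (Fin d → G))
    (hS : ∀ k ∈ S, ∀ i, c (k i) ∈ F ∨ p ≤ #{j | c (k j) = c (k i)}) :
    #S ≤ Fintype.card G ^ (d / p) * (q * (#F + d)) ^ d := by
  have hsub : S ⊆ (univ : Finset (Fin (d / p) → G)).biUnion fun g ↦
      Fintype.piFinset fun _ ↦ {x | c x ∈ F ∪ univ.image (c ∘ g)} := by
    intro k hk
    let T := ({i | p ≤ #{j | c (k j) = c (k i)}} : Finset (Fin d)).image (c ∘ k)
    have hTp : ∀ t ∈ T, p ≤ #{j | c (k j) = t} := by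
      intro t ht
      obtain ⟨i, hi, rfl⟩ := mem_image.1 ht
      exact (mem_filter.1 hi).2
    have hT : #T ≤ d / p := by
      rw [Nat.le_div_iff_mul_le hp]
      calc #T * p ≤ ∑ t ∈ T, #{j | c (k j) = t} := card_nsmul_le_sum _ _ _ hTp
        _ = #(T.biUnion fun t ↦ {j | c (k j) = t}) := by
          refine (card_biUnion fun t _ t' _ htt' ↦ disjoint_left.2 fun j hj hj' ↦ htt' ?_).symm
          exact (mem_filter.1 hj).2.symm.trans (mem_filter.1 hj').2
        _ ≤ d := (card_le_univ _).trans (Fintype.card_fin d).le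
    have hrep : ∀ t : T, ∃ x, c x = t := fun t ↦ by
      obtain ⟨i, -, hi⟩ := mem_image.1 t.2
      exact ⟨k i, hi⟩
    choose rep hrep using hrep
    let g : Fin (d / p) → G := fun s ↦
      if h : (s : ℕ) < #T then rep (T.equivFin.symm ⟨s, h⟩) else Classical.arbitrary G
    refine mem_biUnion.2 ⟨g, mem_univ _, Fintype.mem_piFinset.2 fun i ↦ ?_⟩
    simp only [mem_filter, mem_univ, true_and, mem_union]
    refine (hS k hk i).imp_right fun hi ↦ ?_
    have ht : c (k i) ∈ T := mem_image.2 ⟨i, mem_filter.2 ⟨mem_univ _, hi⟩, rfl⟩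
    refine mem_image.2 ⟨⟨T.equivFin ⟨_, ht⟩, (Fin.is_lt _).trans_le hT⟩, mem_univ _, ?_⟩
    simp [g, hrep]
  refine (card_le_card hsub).trans ((card_biUnion_le_card_mul _ _ ((q * (#F + d)) ^ d) ?_).trans ?_)
  · intro g _
    rw [Fintype.card_piFinset_const]
    refine Nat.pow_le_pow_left ?_ d
    refine (card_le_mul_card_image_of_maps_to (f := c) (t := F ∪ univ.image (c ∘ g))
      (fun x hx ↦ (mem_filter.1 hx).2) q
      fun t _ ↦ (card_le_card (filter_subset_filter _ (subset_univ _))).trans (hq t)).trans ?_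
    refine Nat.mul_le_mul_left q ((card_union_le _ _).trans (Nat.add_le_add_left ?_ _))
    exact card_image_le.trans ((Fintype.card_fin _).le.trans (Nat.div_le_self d p))
  · simp

theorem card_fiber_pow_add_inv_le {G : Type*} [Fintype G] {z : G → ℂ}
    (hz : Function.Injective z) (hz0 : ∀ x, z x ≠ 0) {P : ℕ} (hP : 0 < P) (t : ℂ) :
    #{x | z x ^ P + (z x ^ P)⁻¹ = t} ≤ 2 * P := by
  classical
  rcases Finset.eq_empty_or_nonempty ({x | z x ^ P + (z x ^ P)⁻¹ = t} : Finset G) with h | ⟨y, hy⟩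
  · simp [h]
  · have hy' := (mem_filter.1 hy).2
    have hcard : ∀ a : ℂ, #(Polynomial.nthRoots P a).toFinset ≤ P := fun a ↦
      (Multiset.toFinset_card_le _).trans (Polynomial.card_nthRoots P a)
    refine (card_le_card_of_injOn z (t := (Polynomial.nthRoots P (z y ^ P)).toFinset ∪
      (Polynomial.nthRoots P (z y ^ P)⁻¹).toFinset) ?_ hz.injOn).trans
      ((card_union_le _ _).trans ?_)
    · intro x hx
      have hx' := (mem_filter.1 hx).2
      have hxne := pow_ne_zero P (hz0 x)
      have hyne := pow_ne_zero P (hz0 y)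
      rw [← hy'] at hx'
      have hprod : (z x ^ P - z y ^ P) * (z x ^ P - (z y ^ P)⁻¹) = 0 := by
        generalize z x ^ P = u at *
        generalize z y ^ P = v at *
        field_simp at hx' ⊢
        linear_combination hx'
      simp only [coe_union, Set.mem_union, mem_coe, Multiset.mem_toFinset,
        Polynomial.mem_nthRoots hP]
      exact (mul_eq_zero.1 hprod).imp sub_eq_zero.1 sub_eq_zero.1
    · have h1 := hcard (z y ^ P)
      have h2 := hcard (z y ^ P)⁻¹
      omega

theorem two_mul_cos_eq_pow_add_inv (N k : ℕ) :
    ((2 * Real.cos (2 * Real.pi * k / N) : ℝ) : ℂ) =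
      Complex.exp (2 * Real.pi * Complex.I / N) ^ k +
        (Complex.exp (2 * Real.pi * Complex.I / N) ^ k)⁻¹ := by
  rw [← Complex.exp_nat_mul, ← Complex.exp_neg]
  push_cast
  rw [Complex.two_cos]
  ring_nf

/-- The multiplicity bound with natural exponent and explicit constant. -/
theorem torusMult_le (d N : ℕ) (hN : 2 ≤ N) (μ : ℝ) :
    torusMult N d μ ≤
      N ^ (d / N.minFac) * (2 * primorial (4 * d) * (d + 2 + d)) ^ d := by
  classical
  have hN0 : N ≠ 0 := by omega
  have : NeZero N := ⟨hN0⟩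
  have hω := Complex.isPrimitiveRoot_exp N hN0
  set ω := Complex.exp (2 * Real.pi * Complex.I / N)
  let z : Fin N → ℂ := fun k ↦ ω ^ (k : ℕ)
  have hz : ∀ k, z k ^ N = 1 := fun k ↦ by
    rw [← pow_mul, mul_comm, pow_mul, hω.pow_eq_one, one_pow]
  have hinj : Function.Injective z := fun k l hkl ↦
    Fin.ext (hω.pow_inj k.2 l.2 hkl)
  have hz0 : ∀ k, z k ≠ 0 := fun k ↦ pow_ne_zero _ (hω.ne_zero hN0)
  set P := primorial (4 * d) with hP
  let κ : ℂ → ℂ := fun x ↦ x ^ P + (x ^ P)⁻¹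
  let S : Finset (Fin d → Fin N) :=
    {k | (∑ j, 2 * Real.cos (2 * Real.pi * (k j : ℝ) / N)) = μ}
  have hmult : torusMult N d μ = #S := by
    rw [torusMult, Nat.card_eq_fintype_card, Fintype.card_subtype]
  have hsum : ∀ k ∈ S, ∑ j, (z (k j) + (z (k j))⁻¹) = (μ : ℂ) := by
    intro k hk
    rw [← (mem_filter.1 hk).2, Complex.ofReal_sum]
    exact sum_congr rfl fun j _ ↦ (two_mul_cos_eq_pow_add_inv N (k j)).symm
  rw [hmult]
  rcases S.eq_empty_or_nonempty with hS | ⟨k₀, hk₀⟩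
  · simp [hS]
  · let F : Finset ℂ := {2, -2} ∪ univ.image fun j ↦ κ (z (k₀ j))
    have hF : #F ≤ d + 2 := by
      have h1 : #({2, -2} : Finset ℂ) ≤ 2 := card_le_two
      have h2 : #(univ.image fun j ↦ κ (z (k₀ j))) ≤ d :=
        card_image_le.trans (Fintype.card_fin d).le
      have h3 : #F ≤ _ := card_union_le _ _
      omega
    refine (card_le_of_large_fibers N.minFac_pos (fun k ↦ κ (z k)) (q := 2 * P)
      (card_fiber_pow_add_inv_le hinj hz0 (primorial_pos _)) F S fun k hk i ↦ ?_).trans ?_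
    · refine or_iff_not_imp_left.2 fun hi ↦ ?_
      simp only [F, mem_union, mem_insert, mem_singleton, mem_image, mem_univ, true_and,
        not_or, not_exists] at hi
      exact minFac_le_card_filter_of_sum_eq (by omega) (fun j ↦ hz (k j)) (fun j ↦ hz (k₀ j))
        ((hsum k hk).trans (hsum k₀ hk₀).symm) hP (fun _ ↦ rfl) i hi.1.1 hi.1.2
        fun j ↦ (hi.2 j ·.symm)
    · rw [Fintype.card_fin]
      gcongr

theorem mult_global_bound (d : ℕ) (hd : 1 ≤ d) :
    ∃ C : ℝ, 0 < C ∧ ∀ N : ℕ, 2 ≤ N → ∀ μ : ℝ, 1 ≤ torusMult N d μ →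
      (torusMult N d μ : ℝ) ≤ C * (N : ℝ) ^ ((d : ℝ) / (N.minFac : ℝ)) ∧
      (torusMult N d μ : ℝ) ≤ C * (N : ℝ) ^ ((d : ℝ) / 2) := by
  refine ⟨((2 * primorial (4 * d) * (d + 2 + d)) ^ d : ℕ), ?_, fun N hN μ _ ↦ ?_⟩
  · have := primorial_pos (4 * d)
    exact_mod_cast (by positivity)
  have hN1 : (1 : ℝ) ≤ N := by exact_mod_cast (by omega : 1 ≤ N)
  have hmin : (2 : ℝ) ≤ N.minFac := by
    exact_mod_cast (Nat.minFac_prime (by omega : N ≠ 1)).two_le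
  have hmain : (torusMult N d μ : ℝ) ≤ ((2 * primorial (4 * d) * (d + 2 + d)) ^ d : ℕ) *
      (N : ℝ) ^ ((d : ℝ) / (N.minFac : ℝ)) := by
    calc (torusMult N d μ : ℝ)
        ≤ (N ^ (d / N.minFac) * (2 * primorial (4 * d) * (d + 2 + d)) ^ d : ℕ) := by
          exact_mod_cast torusMult_le d N hN μ
      _ = ((2 * primorial (4 * d) * (d + 2 + d)) ^ d : ℕ) *
          (N : ℝ) ^ ((d / N.minFac : ℕ) : ℝ) := by
        rw [Real.rpow_natCast, Nat.cast_mul, mul_comm, Nat.cast_pow N]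
      _ ≤ _ := by
        gcongr
        exact Nat.cast_div_le
  refine ⟨hmain, hmain.trans ?_⟩
  gcongr
end
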